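/- arXiv:1303.2865 — 6 statements merged into one kernel-verified Lean document; each statement's English description precedes it below -/
import Mathlib

section
/- Let B be a Boolean algebra and let X ⊆ B be a subset closed under the meet operation ∧ such that X generates B (every element of B is a Boolean combination, using ∨, ∧, ¬, of finitely many elements of X). Then the set {1_{K(b)} : b ∈ X} ∪ {1}, where 1 is the constant function with value 1 on S(B), contains a basis of the vector space V(B). -/
/-- The Stone space of a Boolean algebra `B`: ultrafilters on `B`, encoded as Boolean algebra
homomorphisms `B → Bool`, with the topology induced from the product topology on `B → Bool`. -/
def StoneSpace (B : Type*) [BooleanAlgebra B] : Type _ :=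
  {x : B → Bool // x ⊤ = true ∧ x ⊥ = false ∧
    (∀ a b, x (a ⊓ b) = (x a && x b)) ∧ (∀ a b, x (a ⊔ b) = (x a || x b)) ∧
    (∀ a, x aᶜ = !(x a))}

instance (B : Type*) [BooleanAlgebra B] : TopologicalSpace (StoneSpace B) :=
  instTopologicalSpaceSubtype

/-- The indicator function `1_{K(b)} : S(B) → ℝ` of the basic clopen set `K(b)`. -/
def stoneIndicator {B : Type*} [BooleanAlgebra B] (b : B) : StoneSpace B → ℝ :=
  fun x => if x.1 b = true then 1 else 0

/-- The vector space `V(B)` of simple functions: the span of the indicators of the sets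
`K(b)`, `b ∈ B`. -/
noncomputable def simpleFunctions (B : Type*) [BooleanAlgebra B] :
    Submodule ℝ (StoneSpace B → ℝ) :=
  Submodule.span ℝ (Set.range (stoneIndicator (B := B)))

/-- `IsBooleanCombination X b` means that `b` can be obtained as a Boolean function (a finite
combination of `⊔`, `⊓` and `ᶜ`) of finitely many elements of `X`. -/
inductive IsBooleanCombination {B : Type*} [BooleanAlgebra B] (X : Set B) : B → Prop
  | base {b : B} : b ∈ X → IsBooleanCombination X b
  | sup {a b : B} : IsBooleanCombination X a → IsBooleanCombination X b →
      IsBooleanCombination X (a ⊔ b)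
  | inf {a b : B} : IsBooleanCombination X a → IsBooleanCombination X b →
      IsBooleanCombination X (a ⊓ b)
  | compl {a : B} : IsBooleanCombination X a → IsBooleanCombination X aᶜ

/-- Let `X ⊆ B` be closed under meets and generate `B` (every element of `B`
is a Boolean combination of finitely many elements of `X`). Then the set
`{1_{K(b)} : b ∈ X} ∪ {1}` (where `1` is the constant function of value `1`) contains a basis
of the vector space `V(B)`: there is a linearly independent subset of it spanning `V(B)`. -/
theorem meet_semilattice_indicators_contain_basis (B : Type*) [BooleanAlgebra B]
    (X : Set B)
    (hmeet : ∀ a ∈ X, ∀ b ∈ X, a ⊓ b ∈ X)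
    (hgen : ∀ b : B, IsBooleanCombination X b) :
    ∃ s : Set (StoneSpace B → ℝ),
      s ⊆ (stoneIndicator '' X ∪ {fun _ => (1 : ℝ)}) ∧
      LinearIndependent ℝ ((↑) : s → (StoneSpace B → ℝ)) ∧
      Submodule.span ℝ s = simpleFunctions B := by
  classical
  set S : Set (StoneSpace B → ℝ) := stoneIndicator '' X ∪ {fun _ => (1 : ℝ)} with hS
  have hinf : ∀ a b : B, stoneIndicator (a ⊓ b) = stoneIndicator a * stoneIndicator b := by
    intro a b
    funext x
    have h := x.2.2.2.1 a b
    simp only [stoneIndicator, Pi.mul_apply, h]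
    cases x.1 a <;> cases x.1 b <;> simp
  have hsup : ∀ a b : B, stoneIndicator (a ⊔ b) =
      stoneIndicator a + stoneIndicator b - stoneIndicator a * stoneIndicator b := by
    intro a b
    funext x
    have h := x.2.2.2.2.1 a b
    simp only [stoneIndicator, Pi.mul_apply, Pi.add_apply, Pi.sub_apply, h]
    cases x.1 a <;> cases x.1 b <;> simp
  have hcompl : ∀ a : B, stoneIndicator aᶜ = (fun _ => (1 : ℝ)) - stoneIndicator a := by
    intro a
    funext x
    have h := x.2.2.2.2.2 a
    simp only [stoneIndicator, Pi.sub_apply, h]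
    cases x.1 a <;> simp
  have htop : stoneIndicator (⊤ : B) = fun _ => (1 : ℝ) := by
    funext x
    simp [stoneIndicator, x.2.1]
  have hone : (fun _ => (1 : ℝ)) ∈ Submodule.span ℝ S :=
    Submodule.subset_span (Or.inr rfl)
  have hone' : (fun _ : StoneSpace B => (1 : ℝ)) = 1 := rfl
  have hSS : Set.image2 (· * ·) S S ⊆ S := by
    rintro _ ⟨f, hf, g, hg, rfl⟩
    rcases hf with ⟨a, ha, rfl⟩ | hf
    · rcases hg with ⟨b, hb, rfl⟩ | hg
      · exact Or.inl ⟨a ⊓ b, hmeet a ha b hb, hinf a b⟩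
      · rw [Set.mem_singleton_iff] at hg
        subst hg
        left
        exact ⟨a, ha, by simp [hone']⟩
    · rw [Set.mem_singleton_iff] at hf
      subst hf
      simpa [hone'] using hg
  have hmul : ∀ f ∈ Submodule.span ℝ S, ∀ g ∈ Submodule.span ℝ S,
      f * g ∈ Submodule.span ℝ S := by
    intro f hf g hg
    have h := Submodule.mul_mem_mul hf hg
    rw [Submodule.span_mul_span] at h
    exact Submodule.span_mono hSS h
  have hall : ∀ b : B, stoneIndicator b ∈ Submodule.span ℝ S := by
    intro b
    induction hgen b with
    | base hb => exact Submodule.subset_span (Or.inl ⟨_, hb, rfl⟩)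
    | sup _ _ iha ihb =>
      rw [hsup]
      exact Submodule.sub_mem _ (Submodule.add_mem _ iha ihb) (hmul _ iha _ ihb)
    | inf _ _ iha ihb =>
      rw [hinf]
      exact hmul _ iha _ ihb
    | compl _ iha =>
      rw [hcompl]
      exact Submodule.sub_mem _ hone iha
  have hspan : Submodule.span ℝ S = simpleFunctions B := by
    apply le_antisymm
    · refine Submodule.span_le.2 ?_
      rintro f (⟨a, _, rfl⟩ | hf)
      · exact Submodule.subset_span ⟨a, rfl⟩
      · rw [Set.mem_singleton_iff] at hf
        subst hf
        exact Submodule.subset_span ⟨⊤, htop⟩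
    · refine Submodule.span_le.2 ?_
      rintro _ ⟨b, rfl⟩
      exact hall b
  obtain ⟨s, hsS, hss, hli⟩ := exists_linearIndependent ℝ S
  exact ⟨s, hsS, hli, hss.trans hspan⟩
end

section
/- Let B be a Boolean algebra, let ba(B) be the Banach space of bounded finitely additive real-valued functions on B equipped with the norm ‖f‖ = sup_{b∈B} f(b) − inf_{b∈B} f(b), let S(B) be the Stone space of B, and let rca(S(B)) be the Banach space of regular countably additive signed Borel measures on S(B) equipped with the total variation norm. Then the mapping C_K : rca(S(B)) → ba(B) defined by C_K(μ)(b) = μ({x ∈ S(B) : b ∈ x}) is an isometric isomorphism of Banach spaces. -/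
open MeasureTheory

/-- The Borel σ-algebra on the Stone space. -/
instance (B : Type*) [BooleanAlgebra B] : MeasurableSpace (StoneSpace B) :=
  borel (StoneSpace B)

instance (B : Type*) [BooleanAlgebra B] : BorelSpace (StoneSpace B) := ⟨rfl⟩

/-- The basic clopen set `K(b) = {x ∈ S(B) : b ∈ x}`. -/
def KSet {B : Type*} [BooleanAlgebra B] (b : B) : Set (StoneSpace B) :=
  {x | x.1 b = true}

/-- `f : B → ℝ` is additive: `x ⊓ y = ⊥` implies `f (x ⊔ y) = f x + f y`. -/
def IsAdditive {B : Type*} [BooleanAlgebra B] (f : B → ℝ) : Prop :=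
  ∀ x y : B, x ⊓ y = ⊥ → f (x ⊔ y) = f x + f y

/-- `f` is a bounded additive real-valued function on `B`, i.e. an element of `ba(B)`. -/
def IsBddAdditive {B : Type*} [BooleanAlgebra B] (f : B → ℝ) : Prop :=
  IsAdditive f ∧ BddAbove (Set.range f) ∧ BddBelow (Set.range f)

/-- The norm of `ba(B)`: `‖f‖ = sup_{b ∈ B} f b − inf_{b ∈ B} f b`. -/
noncomputable def baNorm {B : Type*} [BooleanAlgebra B] (f : B → ℝ) : ℝ :=
  sSup (Set.range f) - sInf (Set.range f)

namespace StoneAux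

variable {B : Type*} [BooleanAlgebra B]

lemma mem_KSet {b : B} {x : StoneSpace B} : x ∈ KSet b ↔ x.1 b = true := Iff.rfl

lemma KSet_top : KSet (⊤ : B) = Set.univ := by
  ext x; simp [mem_KSet, x.2.1]

lemma KSet_bot : KSet (⊥ : B) = ∅ := by
  ext x; simp [mem_KSet, x.2.2.1]

lemma KSet_inf (a b : B) : KSet (a ⊓ b) = KSet a ∩ KSet b := by
  ext x; simp [mem_KSet, x.2.2.2.1 a b]

lemma KSet_sup (a b : B) : KSet (a ⊔ b) = KSet a ∪ KSet b := by
  ext x; simp [mem_KSet, x.2.2.2.2.1 a b]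

lemma KSet_compl (a : B) : KSet aᶜ = (KSet a)ᶜ := by
  ext x; simp [mem_KSet, x.2.2.2.2.2 a]

lemma KSet_mono {a b : B} (h : a ≤ b) : KSet a ⊆ KSet b := by
  have := KSet_sup a b
  rw [sup_eq_right.2 h] at this
  rw [this]; exact Set.subset_union_left

lemma exists_point {c : B} (hc : c ≠ ⊥) : ∃ x : StoneSpace B, x ∈ KSet c := by
  classical
  have hd : Disjoint ((Order.PFilter.principal c : Order.PFilter B) : Set B)
      ((Order.Ideal.principal (⊥ : B) : Order.Ideal B) : Set B) := by
    rw [Set.disjoint_left]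
    intro a ha hb
    have h1 : c ≤ a := Order.PFilter.mem_principal.1 ha
    have h2 : a ≤ ⊥ := hb
    exact hc (le_bot_iff.1 (h1.trans h2))
  obtain ⟨J, hJ, -, hcJ⟩ := DistribLattice.prime_ideal_of_disjoint_filter_ideal hd
  have hcn : c ∉ J := fun h => Set.disjoint_left.1 hcJ (Order.PFilter.mem_principal.2 le_rfl) h
  have htop : (⊤ : B) ∉ J := fun h => hcn (J.lower le_top h)
  have hinf : ∀ a b, a ⊓ b ∈ J ↔ (a ∈ J ∨ b ∈ J) := fun a b =>
    ⟨hJ.mem_or_mem, fun h => h.elim (fun h => J.lower inf_le_left h)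
      (fun h => J.lower inf_le_right h)⟩
  have hcompl : ∀ a, aᶜ ∈ J ↔ a ∉ J := fun a =>
    ⟨fun h h' => htop (by
      have := Order.Ideal.sup_mem h' h
      rwa [sup_compl_eq_top] at this), fun h => hJ.compl_mem_of_notMem h⟩
  refine ⟨⟨fun a => decide (a ∉ J), ?_, ?_, ?_, ?_, ?_⟩, ?_⟩
  · simpa using htop
  · simp
  · intro a b; simp [hinf]
  · intro a b
    simp only [Order.Ideal.sup_mem_iff]
    by_cases ha : a ∈ J <;> by_cases hb : b ∈ J <;> simp [ha, hb]
  · intro a; by_cases ha : a ∈ J <;> simp [ha, hcompl]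
  · exact decide_eq_true hcn

lemma le_of_KSet_subset {a b : B} (h : KSet a ⊆ KSet b) : a ≤ b := by
  by_contra hab
  have : a ⊓ bᶜ ≠ ⊥ := fun h0 => hab (by
    rw [← disjoint_iff] at h0
    exact (le_compl_iff_disjoint_right.2 h0).trans (by simp))
  obtain ⟨x, hx⟩ := exists_point this
  rw [KSet_inf, KSet_compl] at hx
  exact hx.2 (h hx.1)

lemma continuous_eval (b : B) : Continuous (fun x : StoneSpace B => x.1 b) :=
  (continuous_apply b).comp continuous_subtype_val

lemma isClopen_KSet (b : B) : IsClopen (KSet b) :=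
  (isClopen_discrete {true}).preimage (continuous_eval b)

lemma measurable_KSet (b : B) : MeasurableSet (KSet b) := (isClopen_KSet b).isOpen.measurableSet

instance : T2Space (StoneSpace B) := inferInstanceAs (T2Space (Subtype _))

instance : CompactSpace (StoneSpace B) := by
  refine isCompact_iff_compactSpace.1 (IsClosed.isCompact ?_)
  refine IsClosed.inter (isClosed_eq (continuous_apply _) continuous_const) ?_
  refine IsClosed.inter (isClosed_eq (continuous_apply _) continuous_const) ?_
  have hop : ∀ (g : Bool → Bool → Bool) (a b : B),
      Continuous (fun x : B → Bool => g (x a) (x b)) := fun g a b =>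
    Continuous.comp (g := fun p : Bool × Bool => g p.1 p.2) (f := fun x : B → Bool => (x a, x b))
      continuous_of_discreteTopology ((continuous_apply a).prodMk (continuous_apply b))
  refine IsClosed.inter ?_ (IsClosed.inter ?_ ?_)
  · change IsClosed {x : B → Bool | ∀ a b, x (a ⊓ b) = (x a && x b)}
    simp only [Set.ofPred_forall]
    exact isClosed_iInter fun a => isClosed_iInter fun b =>
      isClosed_eq (continuous_apply _) (hop _ a b)
  · change IsClosed {x : B → Bool | ∀ a b, x (a ⊔ b) = (x a || x b)}
    simp only [Set.ofPred_forall]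
    exact isClosed_iInter fun a => isClosed_iInter fun b =>
      isClosed_eq (continuous_apply _) (hop _ a b)
  · change IsClosed {x : B → Bool | ∀ a, x aᶜ = !(x a)}
    simp only [Set.ofPred_forall]
    exact isClosed_iInter fun a =>
      isClosed_eq (continuous_apply _) (hop (fun p _ => !p) a a)

lemma exists_finset_inf (x : StoneSpace B) (I : Finset B) :
    ∃ b : B, x ∈ KSet b ∧ ∀ y ∈ KSet b, ∀ i ∈ I, y.1 i = x.1 i := by
  classical
  induction I using Finset.induction_on with
  | empty => exact ⟨⊤, by simp [KSet_top], by simp⟩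
  | insert i I _ ih =>
    obtain ⟨b, hxb, hb⟩ := ih
    have key : ∃ c : B, x ∈ KSet c ∧ ∀ y ∈ KSet c, y.1 i = x.1 i := by
      by_cases h : x ∈ KSet i
      · exact ⟨i, h, fun y hy => by rw [mem_KSet] at h hy; rw [h, hy]⟩
      · refine ⟨iᶜ, by rwa [KSet_compl], fun y hy => ?_⟩
        rw [KSet_compl, Set.mem_compl_iff, mem_KSet] at hy
        rw [mem_KSet] at h
        simp only [Bool.not_eq_true] at h hy
        rw [h, hy]
    obtain ⟨c, hxc, hc⟩ := key
    refine ⟨c ⊓ b, by rw [KSet_inf]; exact ⟨hxc, hxb⟩, fun y hy j hj => ?_⟩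
    rw [KSet_inf] at hy
    rcases Finset.mem_insert.1 hj with rfl | hj
    · exact hc y hy.1
    · exact hb y hy.2 j hj

lemma exists_basis {U : Set (StoneSpace B)} (hU : IsOpen U) {x : StoneSpace B} (hx : x ∈ U) :
    ∃ b : B, x ∈ KSet b ∧ KSet b ⊆ U := by
  obtain ⟨V, hV, rfl⟩ := isOpen_induced_iff.1 hU
  obtain ⟨I, u, h1, h2⟩ := isOpen_pi_iff.1 hV x.1 hx
  obtain ⟨b, hb, hb'⟩ := exists_finset_inf x I
  refine ⟨b, hb, fun y hy => h2 ?_⟩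
  intro i hi
  have : y.1 i = x.1 i := hb' y hy i hi
  rw [this]
  exact (h1 i hi).2

lemma exists_between {C U : Set (StoneSpace B)} (hC : IsCompact C) (hU : IsOpen U) (h : C ⊆ U) :
    ∃ b : B, C ⊆ KSet b ∧ KSet b ⊆ U := by
  refine hC.induction_on (p := fun s => ∃ b : B, s ⊆ KSet b ∧ KSet b ⊆ U) ?_ ?_ ?_ ?_
  · exact ⟨⊥, by simp, by simp [KSet_bot]⟩
  · rintro s t hst ⟨b, h1, h2⟩; exact ⟨b, hst.trans h1, h2⟩
  · rintro s t ⟨b, h1, h2⟩ ⟨c, h3, h4⟩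
    refine ⟨b ⊔ c, ?_, ?_⟩ <;> rw [KSet_sup]
    · exact Set.union_subset_union h1 h3
    · exact Set.union_subset h2 h4
  · intro x hx
    obtain ⟨b, h1, h2⟩ := exists_basis hU (h hx)
    exact ⟨KSet b, mem_nhdsWithin_of_mem_nhds ((isClopen_KSet b).isOpen.mem_nhds h1), b,
      subset_rfl, h2⟩

open scoped NNReal ENNReal
open TopologicalSpace

lemma nn_mono {g : B → ℝ≥0} (hg : ∀ x y : B, x ⊓ y = ⊥ → g (x ⊔ y) = g x + g y) {a b : B}
    (h : a ≤ b) : g a ≤ g b := by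
  have := hg a (b \ a) (by simp)
  rw [sup_sdiff_cancel_right h] at this
  rw [this]; exact le_self_add

lemma nn_sup_le {g : B → ℝ≥0} (hg : ∀ x y : B, x ⊓ y = ⊥ → g (x ⊔ y) = g x + g y) (a b : B) :
    g (a ⊔ b) ≤ g a + g b := by
  have := hg a (b \ a) (by simp)
  rw [sup_sdiff_self_right] at this
  rw [this]
  gcongr
  exact nn_mono hg sdiff_le

/-- Content on compact sets induced by a nonnegative additive function. -/
noncomputable def lam (g : B → ℝ≥0) (K : Set (StoneSpace B)) : ℝ≥0 :=
  ⨅ b : {b : B // K ⊆ KSet b}, g b.1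

instance (K : Set (StoneSpace B)) : Nonempty {b : B // K ⊆ KSet b} :=
  ⟨⟨⊤, by simp [KSet_top]⟩⟩

lemma lam_le (g : B → ℝ≥0) {K : Set (StoneSpace B)} {b : B} (h : K ⊆ KSet b) : lam g K ≤ g b :=
  ciInf_le' (fun b : {b : B // K ⊆ KSet b} => g b.1) ⟨b, h⟩

lemma le_lam {g : B → ℝ≥0} {K : Set (StoneSpace B)} {r : ℝ≥0}
    (h : ∀ b, K ⊆ KSet b → r ≤ g b) : r ≤ lam g K :=
  le_ciInf fun b => h b.1 b.2

lemma lam_KSet {g : B → ℝ≥0} (hg : ∀ x y : B, x ⊓ y = ⊥ → g (x ⊔ y) = g x + g y) (b : B) :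
    lam g (KSet b) = g b :=
  le_antisymm (lam_le g subset_rfl) (le_lam fun _ h => nn_mono hg (le_of_KSet_subset h))

lemma lam_union_le {g : B → ℝ≥0} (hg : ∀ x y : B, x ⊓ y = ⊥ → g (x ⊔ y) = g x + g y)
    (K L : Set (StoneSpace B)) : lam g (K ∪ L) ≤ lam g K + lam g L := by
  refine NNReal.le_iInf_add_iInf fun a b => ?_
  refine (lam_le g (b := a.1 ⊔ b.1) ?_).trans (nn_sup_le hg _ _)
  rw [KSet_sup]
  exact Set.union_subset_union a.2 b.2

/-- The content. -/
noncomputable def cont (g : B → ℝ≥0) (hg : ∀ x y : B, x ⊓ y = ⊥ → g (x ⊔ y) = g x + g y) :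
    Content (StoneSpace B) where
  toFun K := lam g K
  mono' K L h := le_lam fun _ hb => lam_le g (h.trans hb)
  sup_le' K L := by
    rw [Compacts.coe_sup]; exact lam_union_le hg _ _
  sup_disjoint' K L h _ hL := by
    rw [Compacts.coe_sup]
    refine le_antisymm (lam_union_le hg _ _) (le_lam fun c hc => ?_)
    obtain ⟨b, h1, h2⟩ := exists_between K.isCompact hL.isOpen_compl h.subset_compl_right
    have e := hg (c ⊓ b) (c ⊓ bᶜ) (by rw [← inf_inf_distrib_left]; simp)
    rw [← inf_sup_left, sup_compl_eq_top, inf_top_eq] at e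
    rw [e]
    refine add_le_add (lam_le g ?_) (lam_le g ?_)
    · rw [KSet_inf]; exact Set.subset_inter (Set.subset_union_left.trans hc) h1
    · rw [KSet_inf, KSet_compl]
      exact Set.subset_inter (Set.subset_union_right.trans hc) (Set.subset_compl_comm.1 h2)

lemma exists_measure (g : B → ℝ≥0) (hg : ∀ x y : B, x ⊓ y = ⊥ → g (x ⊔ y) = g x + g y) :
    ∃ m : Measure (StoneSpace B), IsFiniteMeasure m ∧ m.Regular ∧ ∀ b, m (KSet b) = g b := by
  have h : ∀ b, (cont g hg).measure (KSet b) = g b := by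
    intro b
    rw [Content.measure_apply _ (measurable_KSet b),
      Content.outerMeasure_of_isOpen _ _ (isClopen_KSet b).isOpen,
      Content.innerContent_of_isCompact _ (isClopen_KSet b).isClosed.isCompact]
    change ((lam g (KSet b) : ℝ≥0) : ℝ≥0∞) = _
    rw [lam_KSet hg]
  refine ⟨(cont g hg).measure, ⟨?_⟩, inferInstance, h⟩
  rw [← KSet_top, h]; exact ENNReal.coe_lt_top

lemma split_apply (μ : SignedMeasure (StoneSpace B)) {A K : Set (StoneSpace B)}
    (hA : MeasurableSet A) (hK : MeasurableSet K) : μ A = μ (A ∩ K) + μ (A \ K) := by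
  rw [← VectorMeasure.of_union (Set.disjoint_sdiff_right.mono_left Set.inter_subset_right)
    (hA.inter hK) (hA.diff hK), Set.inter_union_sdiff]

lemma approx (ρ : Measure (StoneSpace B)) [IsFiniteMeasure ρ] [ρ.Regular]
    (μ : SignedMeasure (StoneSpace B)) (hμ : ∀ A, MeasurableSet A → |μ A| ≤ ρ.real A)
    {A : Set (StoneSpace B)} (hA : MeasurableSet A) {ε : ℝ} (hε : 0 < ε) :
    ∃ b : B, |μ (KSet b) - μ A| < ε := by
  have hε' : ENNReal.ofReal (ε / 2) ≠ 0 := by simpa using hε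
  obtain ⟨C, hCA, hC, h1⟩ := hA.exists_isCompact_sdiff_lt (measure_ne_top ρ A) hε'
  obtain ⟨U, hAU, hU, -, h2⟩ := hA.exists_isOpen_sdiff_lt (measure_ne_top ρ A) hε'
  obtain ⟨b, h3, h4⟩ := exists_between hC hU (hCA.trans hAU)
  have hK := measurable_KSet b
  have r1 : ρ.real (A \ C) < ε / 2 := by
    rw [measureReal_def]; exact (ENNReal.lt_ofReal_iff_toReal_lt (measure_ne_top _ _)).1 h1
  have r2 : ρ.real (U \ A) < ε / 2 := by
    rw [measureReal_def]; exact (ENNReal.lt_ofReal_iff_toReal_lt (measure_ne_top _ _)).1 h2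
  have e1 := split_apply μ hA hK
  have e2 := split_apply μ hK hA
  rw [Set.inter_comm] at e2
  have b1 : |μ (A \ KSet b)| ≤ ρ.real (A \ C) :=
    (hμ _ (hA.diff hK)).trans (measureReal_mono (Set.sdiff_subset_sdiff_right h3))
  have b2 : |μ (KSet b \ A)| ≤ ρ.real (U \ A) :=
    (hμ _ (hK.diff hA)).trans (measureReal_mono (Set.sdiff_subset_sdiff_left h4))
  refine ⟨b, ?_⟩
  rw [e1, e2, abs_lt]
  rw [abs_le] at b1 b2
  constructor <;> linarith [b1.1, b1.2, b2.1, b2.2]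

lemma regular_add (ρ σ : Measure (StoneSpace B)) [IsFiniteMeasure ρ] [IsFiniteMeasure σ]
    [ρ.Regular] [σ.Regular] : (ρ + σ).Regular := inferInstance

lemma regular_of_le {ρ σ : Measure (StoneSpace B)} [IsFiniteMeasure ρ]
    [ρ.Regular] (h : σ ≤ ρ) : σ.Regular := by
  have : IsFiniteMeasure σ := isFiniteMeasure_of_le ρ h
  have : σ.InnerRegularCompactLTTop := by
    refine ⟨fun A hA r hr => ?_⟩
    have hε : σ A - r ≠ 0 := (tsub_pos_of_lt hr).ne'
    obtain ⟨C, hCA, hC, h1⟩ := hA.1.exists_isCompact_sdiff_lt (measure_ne_top ρ A) hε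
    refine ⟨C, hCA, hC, ?_⟩
    have h2 : σ (A \ C) < σ A - r := (h _).trans_lt h1
    by_contra hcon
    push Not at hcon
    have h3 : σ A ≤ σ C + σ (A \ C) := by
      conv_lhs => rw [← Set.union_sdiff_cancel hCA]
      exact measure_union_le _ _
    have h4 : σ C + σ (A \ C) < r + (σ A - r) :=
      ENNReal.add_lt_add_of_le_of_lt (measure_ne_top _ _) hcon h2
    rw [add_tsub_cancel_of_le hr.le] at h4
    exact absurd h3 (not_le.2 h4)
  infer_instance

lemma abs_apply_le (μ : SignedMeasure (StoneSpace B)) (A : Set (StoneSpace B)) :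
    |μ A| ≤ μ.totalVariation.real A := by
  simpa using μ.norm_le_totalVariation A

lemma bddAdditive (μ : SignedMeasure (StoneSpace B)) : IsBddAdditive (fun b => μ (KSet b)) := by
  have hb : ∀ b : B, |μ (KSet b)| ≤ μ.totalVariation.real Set.univ := fun b =>
    (abs_apply_le μ _).trans (measureReal_mono (Set.subset_univ _))
  refine ⟨?_, ⟨μ.totalVariation.real Set.univ, ?_⟩, ⟨-μ.totalVariation.real Set.univ, ?_⟩⟩
  · intro x y hxy
    simp only [KSet_sup]
    refine VectorMeasure.of_union ?_ (measurable_KSet x) (measurable_KSet y)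
    rw [Set.disjoint_iff_inter_eq_empty, ← KSet_inf, hxy, KSet_bot]
  · rintro _ ⟨b, rfl⟩; exact (abs_le.1 (hb b)).2
  · rintro _ ⟨b, rfl⟩; exact (abs_le.1 (hb b)).1

lemma inj (μ ν : SignedMeasure (StoneSpace B)) (hμ : μ.totalVariation.Regular)
    (hν : ν.totalVariation.Regular) (h : ∀ b : B, μ (KSet b) = ν (KSet b)) : μ = ν := by
  ext A hA
  by_contra hne
  have hpos : 0 < |μ A - ν A| := abs_pos.2 (sub_ne_zero.2 hne)
  have := regular_add μ.totalVariation ν.totalVariation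
  obtain ⟨b, hb⟩ := approx (μ.totalVariation + ν.totalVariation) (μ - ν) (fun A _ => by
    rw [measureReal_add_apply]
    change |μ A - ν A| ≤ _
    exact (abs_sub _ _).trans (add_le_add (abs_apply_le μ A) (abs_apply_le ν A))) hA hpos
  change |(μ (KSet b) - ν (KSet b)) - (μ A - ν A)| < _ at hb
  rw [h b, sub_self, zero_sub, abs_neg] at hb
  exact lt_irrefl _ hb

lemma isometry (μ : SignedMeasure (StoneSpace B)) (hμ : μ.totalVariation.Regular) :
    (μ.totalVariation Set.univ).toReal = baNorm (fun b => μ (KSet b)) := by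
  obtain ⟨i, hi, hi2, hi3, hp, hn⟩ := μ.toJordanDecomposition_spec
  have hpu : μ.toJordanDecomposition.posPart.real Set.univ = μ i := by
    rw [hp, SignedMeasure.toMeasureOfZeroLE_real_apply _ _ _ MeasurableSet.univ, Set.inter_univ]
  have hnu : μ.toJordanDecomposition.negPart.real Set.univ = - μ iᶜ := by
    rw [hn, SignedMeasure.toMeasureOfLEZero_real_apply _ _ _ MeasurableSet.univ, Set.inter_univ]
  have htv : (μ.totalVariation Set.univ).toReal = μ i - μ iᶜ := by
    rw [← measureReal_def, SignedMeasure.totalVariation, measureReal_add_apply, hpu, hnu]; ring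
  have hap : ∀ b : B, μ (KSet b) = μ.toJordanDecomposition.posPart.real (KSet b)
      - μ.toJordanDecomposition.negPart.real (KSet b) := fun b =>
    μ.apply_eq_posPart_real_sub_negPart_real (measurable_KSet b)
  have hsup : IsLUB (Set.range fun b : B => μ (KSet b)) (μ i) := by
    refine ⟨?_, fun u hu => le_of_forall_pos_le_add fun ε hε => ?_⟩
    · rintro _ ⟨b, rfl⟩
      have h1 := measureReal_mono (μ := μ.toJordanDecomposition.posPart) (Set.subset_univ (KSet b))
      have h2 := measureReal_nonneg (μ := μ.toJordanDecomposition.negPart) (s := KSet b)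
      simp only [hap]; linarith
    · obtain ⟨b, hb⟩ := approx μ.totalVariation μ (fun A _ => abs_apply_le μ A) hi hε
      have : μ (KSet b) ≤ u := hu ⟨b, rfl⟩
      linarith [(abs_lt.1 hb).1]
  have hinf : IsGLB (Set.range fun b : B => μ (KSet b)) (μ iᶜ) := by
    refine ⟨?_, fun u hu => le_of_forall_pos_le_add fun ε hε => ?_⟩
    · rintro _ ⟨b, rfl⟩
      have h1 := measureReal_mono (μ := μ.toJordanDecomposition.negPart) (Set.subset_univ (KSet b))
      have h2 := measureReal_nonneg (μ := μ.toJordanDecomposition.posPart) (s := KSet b)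
      simp only [hap]; linarith
    · obtain ⟨b, hb⟩ := approx μ.totalVariation μ (fun A _ => abs_apply_le μ A) hi.compl hε
      have : u ≤ μ (KSet b) := hu ⟨b, rfl⟩
      linarith [(abs_lt.1 hb).2]
  have hne : (Set.range fun b : B => μ (KSet b)).Nonempty := ⟨_, ⊥, rfl⟩
  rw [htv, baNorm, hsup.csSup_eq hne, hinf.csInf_eq hne]

/-- Positive part of a bounded additive function. -/
noncomputable def pos (f : B → ℝ) (b : B) : ℝ := ⨆ a : {a : B // a ≤ b}, f a.1

lemma le_pos {f : B → ℝ} (hf : BddAbove (Set.range f)) {a b : B} (h : a ≤ b) : f a ≤ pos f b :=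
  le_ciSup (f := fun a : {a : B // a ≤ b} => f a.1)
    (hf.mono (by rintro _ ⟨a, rfl⟩; exact ⟨a.1, rfl⟩)) ⟨a, h⟩

lemma pos_le {f : B → ℝ} {b : B} {r : ℝ} (h : ∀ a, a ≤ b → f a ≤ r) : pos f b ≤ r := by
  have : Nonempty {a : B // a ≤ b} := ⟨⟨b, le_rfl⟩⟩
  exact ciSup_le fun a => h a.1 a.2

lemma pos_add {f : B → ℝ} (hf : IsBddAdditive f) {x y : B} (hxy : x ⊓ y = ⊥) :
    pos f (x ⊔ y) = pos f x + pos f y := by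
  apply le_antisymm
  · refine pos_le fun a ha => ?_
    have e := hf.1 (a ⊓ x) (a ⊓ y) (by rw [← inf_inf_distrib_left, hxy, inf_bot_eq])
    rw [← inf_sup_left, inf_eq_left.2 ha] at e
    rw [e]
    exact add_le_add (le_pos hf.2.1 inf_le_right) (le_pos hf.2.1 inf_le_right)
  · rw [← le_sub_iff_add_le]
    refine pos_le fun a ha => ?_
    rw [le_sub_comm]
    refine pos_le fun c hc => ?_
    have e := hf.1 a c (le_bot_iff.1 ((inf_le_inf ha hc).trans hxy.le))
    have := le_pos hf.2.1 (sup_le_sup ha hc)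
    linarith

lemma surj (f : B → ℝ) (hf : IsBddAdditive f) : ∃ μ : SignedMeasure (StoneSpace B),
    μ.totalVariation.Regular ∧ ∀ b : B, μ (KSet b) = f b := by
  have h0 : f ⊥ = 0 := by
    have := hf.1 ⊥ ⊥ (by simp)
    rw [sup_idem] at this; linarith
  have hp0 : ∀ b, 0 ≤ pos f b := fun b => h0 ▸ le_pos hf.2.1 bot_le
  have hn0 : ∀ b, 0 ≤ pos f b - f b := fun b => sub_nonneg.2 (le_pos hf.2.1 le_rfl)
  obtain ⟨m, hm, hmr, hmK⟩ := exists_measure (fun b => ⟨pos f b, hp0 b⟩) (fun x y h => by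
    ext; exact pos_add hf h)
  obtain ⟨n, hn, hnr, hnK⟩ := exists_measure (fun b => ⟨pos f b - f b, hn0 b⟩) (fun x y h => by
    ext
    change pos f (x ⊔ y) - f (x ⊔ y) = (pos f x - f x) + (pos f y - f y)
    rw [pos_add hf h, hf.1 x y h]; ring)
  have hap : ∀ A, MeasurableSet A → (m.toSignedMeasure - n.toSignedMeasure) A
      = m.real A - n.real A := fun A hA => by
    rw [← Measure.toSignedMeasure_apply_measurable hA,
      ← Measure.toSignedMeasure_apply_measurable hA]; rfl
  refine ⟨m.toSignedMeasure - n.toSignedMeasure, ?_, fun b => ?_⟩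
  · generalize hμ : m.toSignedMeasure - n.toSignedMeasure = μ at hap
    have := regular_add m n
    refine regular_of_le (ρ := m + n) ?_
    obtain ⟨i, hi, hi2, hi3, hp, hq⟩ := μ.toJordanDecomposition_spec
    rw [SignedMeasure.totalVariation]
    refine add_le_add (Measure.le_iff.2 fun A hA => ?_) (Measure.le_iff.2 fun A hA => ?_)
    · rw [← ENNReal.toReal_le_toReal (measure_ne_top _ _) (measure_ne_top _ _), ← measureReal_def,
        ← measureReal_def, hp,
        SignedMeasure.toMeasureOfZeroLE_real_apply _ _ _ hA, hap _ (hi.inter hA)]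
      have h1 : m.real (i ∩ A) ≤ m.real A := measureReal_mono Set.inter_subset_right
      have h2 : 0 ≤ n.real (i ∩ A) := measureReal_nonneg
      linarith
    · rw [← ENNReal.toReal_le_toReal (measure_ne_top _ _) (measure_ne_top _ _), ← measureReal_def,
        ← measureReal_def, hq,
        SignedMeasure.toMeasureOfLEZero_real_apply _ _ _ hA, hap _ (hi.compl.inter hA)]
      have h1 : n.real (iᶜ ∩ A) ≤ n.real A := measureReal_mono Set.inter_subset_right
      have h2 : 0 ≤ m.real (iᶜ ∩ A) := measureReal_nonneg
      linarith
  · rw [hap _ (measurable_KSet b), measureReal_def, measureReal_def, hmK, hnK]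
    change pos f b - (pos f b - f b) = f b
    ring

end StoneAux

/-- The map `C_K : rca(S(B)) → ba(B)`, sending a regular countably additive
signed Borel measure `μ` on the Stone space `S(B)` to the function `b ↦ μ(K(b))`, is an
isometric isomorphism from `rca(S(B))` (with the total variation norm) onto the space `ba(B)`
of bounded additive functions (with the norm `sup − inf`): it is linear, takes values in
`ba(B)`, is injective and surjective onto `ba(B)`, and is norm-preserving. -/
theorem rca_isometric_iso_ba (B : Type*) [BooleanAlgebra B] :
    -- `C_K μ` is a bounded additive function on `B`
    (∀ μ : SignedMeasure (StoneSpace B), μ.totalVariation.Regular →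
      IsBddAdditive (fun b => μ (KSet b))) ∧
    -- linearity (additivity and homogeneity in `μ`)
    (∀ μ ν : SignedMeasure (StoneSpace B), ∀ b : B,
      (μ + ν) (KSet b) = μ (KSet b) + ν (KSet b)) ∧
    (∀ (c : ℝ) (μ : SignedMeasure (StoneSpace B)) (b : B),
      (c • μ) (KSet b) = c * μ (KSet b)) ∧
    -- injectivity
    (∀ μ ν : SignedMeasure (StoneSpace B), μ.totalVariation.Regular →
      ν.totalVariation.Regular → (∀ b : B, μ (KSet b) = ν (KSet b)) → μ = ν) ∧
    -- surjectivity onto `ba(B)`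
    (∀ f : B → ℝ, IsBddAdditive f → ∃ μ : SignedMeasure (StoneSpace B),
      μ.totalVariation.Regular ∧ ∀ b : B, μ (KSet b) = f b) ∧
    -- the map is isometric: total variation norm equals the `ba` norm
    (∀ μ : SignedMeasure (StoneSpace B), μ.totalVariation.Regular →
      (μ.totalVariation Set.univ).toReal = baNorm (fun b => μ (KSet b))) := by
  exact ⟨fun μ _ => StoneAux.bddAdditive μ, fun _ _ _ => rfl, fun _ _ _ => rfl,
    StoneAux.inj, StoneAux.surj, StoneAux.isometry⟩
end

section
/- Let B be a Boolean algebra, let f : B → ℝ be an additive function, and suppose that Σ_{i=1}^n α_i 1_{K(b_i)} = Σ_{i=1}^n β_i 1_{K(b_i)} as functions on the Stone space S(B), where α_i, β_i ∈ ℝ and b_i ∈ B. Then Σ_{i=1}^n α_i f(b_i) = Σ_{i=1}^n β_i f(b_i). Consequently the pairing [f, X] = Σ_i a_i f(b_i) of f with a simple function X = Σ_i a_i 1_{K(b_i)} ∈ V(B) is well defined, independent of the chosen decomposition of X. -/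
open Classical in
theorem exists_stone_point {B : Type*} [BooleanAlgebra B] (c : B) (hc : c ≠ ⊥) :
    ∃ x : StoneSpace B, x.1 c = true := by
  have hd : Disjoint (Order.PFilter.principal c : Set B) (Order.Ideal.principal (⊥ : B) : Set B) := by
    rw [Set.disjoint_left]
    intro a ha hb
    have h1 : c ≤ a := by simpa using ha
    have h2 : a = ⊥ := le_bot_iff.mp (Order.Ideal.mem_principal.mp hb)
    exact hc (by rw [h2] at h1; exact le_bot_iff.mp h1)
  obtain ⟨J, hJ, -, hdJ⟩ := DistribLattice.prime_ideal_of_disjoint_filter_ideal hd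
  have hcJ : c ∉ J := by
    intro h
    exact Set.disjoint_left.mp hdJ (by simp) h
  have htop : (⊤ : B) ∉ J := fun h => hcJ (J.lower le_top h)
  have hbot : (⊥ : B) ∈ J := J.bot_mem
  have hinf : ∀ a b : B, a ⊓ b ∈ J ↔ a ∈ J ∨ b ∈ J := fun a b =>
    ⟨fun h => hJ.mem_or_mem h, fun h => h.elim (fun h => J.lower inf_le_left h)
      (fun h => J.lower inf_le_right h)⟩
  have hsup : ∀ a b : B, a ⊔ b ∈ J ↔ a ∈ J ∧ b ∈ J := fun a b => Order.Ideal.sup_mem_iff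
  have hcompl : ∀ a : B, aᶜ ∈ J ↔ a ∉ J := by
    intro a
    have h1 := hinf a aᶜ
    have h2 := hsup a aᶜ
    simp only [inf_compl_eq_bot, sup_compl_eq_top] at h1 h2
    tauto
  refine ⟨⟨fun a => decide (a ∉ J), by simpa using htop, by simpa using hbot, ?_, ?_, ?_⟩,
    by simpa using hcJ⟩
  · intro a b
    simp [hinf]
  · intro a b
    by_cases h1 : a ∈ J <;> by_cases h2 : b ∈ J <;> simp [hsup, h1, h2]
  · intro a
    by_cases h1 : a ∈ J <;> simp [hcompl, h1]

theorem pairing_aux {B : Type*} [BooleanAlgebra B]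
    (f : B → ℝ) (hf : ∀ x y : B, x ⊓ y = ⊥ → f (x ⊔ y) = f x + f y) (n : ℕ) :
    ∀ (γ : Fin n → ℝ) (b : Fin n → B) (c : B) (r : ℝ),
    (∀ x : StoneSpace B, x.1 c = true → r + ∑ i, γ i * stoneIndicator (b i) x = 0) →
    r * f c + ∑ i, γ i * f (b i ⊓ c) = 0 := by
  have hb : f ⊥ = 0 := by
    have := hf ⊥ ⊥ (by simp)
    simp at this
    exact this
  induction n with
  | zero =>
    intro γ b c r h
    by_cases hc : c = ⊥
    · simp [hc, hb]
    · obtain ⟨x, hx⟩ := exists_stone_point c hc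
      have := h x hx
      simp at this
      simp [this]
  | succ n ih =>
    intro γ b c r h
    have h1 := ih (fun i => γ i.succ) (fun i => b i.succ) (c ⊓ b 0) (r + γ 0) (by
      intro x hx
      rw [x.2.2.2.1, Bool.and_eq_true] at hx
      have := h x hx.1
      rw [Fin.sum_univ_succ] at this
      simp only [stoneIndicator, hx.2] at this ⊢
      simp only [if_true] at this
      linarith)
    have h2 := ih (fun i => γ i.succ) (fun i => b i.succ) (c ⊓ (b 0)ᶜ) r (by
      intro x hx
      rw [x.2.2.2.1, Bool.and_eq_true, x.2.2.2.2.2] at hx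
      have := h x hx.1
      rw [Fin.sum_univ_succ] at this
      have h0 : x.1 (b 0) = false := by simpa using hx.2
      simp only [stoneIndicator, h0] at this ⊢
      simpa using this)
    have key : ∀ a : B, f a = f (a ⊓ b 0) + f (a ⊓ (b 0)ᶜ) := by
      intro a
      rw [← hf _ _ (by rw [inf_inf_inf_comm]; simp), ← inf_sup_left]
      simp
    have h3 : ∑ i : Fin n, γ i.succ * f (b i.succ ⊓ c) =
        ∑ i : Fin n, γ i.succ * f (b i.succ ⊓ (c ⊓ b 0)) +
        ∑ i : Fin n, γ i.succ * f (b i.succ ⊓ (c ⊓ (b 0)ᶜ)) := by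
      rw [← Finset.sum_add_distrib]
      refine Finset.sum_congr rfl fun i _ => ?_
      rw [key (b i.succ ⊓ c), inf_assoc, inf_assoc]
      ring
    rw [Fin.sum_univ_succ, h3, key c, inf_comm (b 0) c]
    linarith

/-- Let `f : B → ℝ` be additive (`x ⊓ y = ⊥` implies
`f (x ⊔ y) = f x + f y`). If `∑ i, α i • 1_{K(bᵢ)} = ∑ i, β i • 1_{K(bᵢ)}` as functions on the
Stone space `S(B)`, then `∑ i, α i * f (bᵢ) = ∑ i, β i * f (bᵢ)`. Consequently the pairing
`[f, X] = ∑ i, aᵢ f(bᵢ)` of `f` with a simple function `X = ∑ i, aᵢ 1_{K(bᵢ)} ∈ V(B)` is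
well defined, independently of the chosen decomposition of `X`. -/
theorem pairing_well_defined (B : Type*) [BooleanAlgebra B]
    (f : B → ℝ) (hf : ∀ x y : B, x ⊓ y = ⊥ → f (x ⊔ y) = f x + f y)
    (n : ℕ) (α β : Fin n → ℝ) (b : Fin n → B)
    (h : ∀ x : StoneSpace B,
      ∑ i : Fin n, α i * stoneIndicator (b i) x = ∑ i : Fin n, β i * stoneIndicator (b i) x) :
    ∑ i : Fin n, α i * f (b i) = ∑ i : Fin n, β i * f (b i) := by
  have := pairing_aux f hf n (fun i => α i - β i) b ⊤ 0 (by
    intro x _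
    have := h x
    simp only [sub_mul, Finset.sum_sub_distrib]
    linarith)
  simp only [sub_mul, Finset.sum_sub_distrib, inf_top_eq] at this
  linarith
end

section
/- Let X be a fragment of FO(L) closed under finite conjunction (a meet semilattice of FO(L)), and let BA(X) be the Boolean algebra generated by X (the closure of X under ∨, ∧ and ¬). Then a sequence (G_n) of finite L-structures is X-convergent if and only if it is BA(X)-convergent. -/
open FirstOrder Filter

/-- A finite `L`-structure (bundled, nonempty). -/
structure FinStruct (L : FirstOrder.Language) where
  carrier : Type
  [struc : L.Structure carrier]
  [fin : Finite carrier]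
  [nonempty : Nonempty carrier]

attribute [instance] FinStruct.struc FinStruct.fin FinStruct.nonempty

/-- The density `⟨φ,G⟩` of a first-order formula `φ` (with free variables indexed by `ℕ`, only
finitely many of which actually occur) in a structure `G`: the proportion of tuples of elements
of `G` (indexed by `{0,…,n-1}` where `n - 1` bounds the indices of the free variables of `φ`)
that satisfy `φ`. -/
noncomputable def densN {L : Language} (φ : L.Formula ℕ) (G : Type*) [L.Structure G] : ℝ :=
  (Nat.card {v : Fin (φ.freeVarFinset.sup id + 1) → G //
      φ.Realize (fun k => v ⟨min k (φ.freeVarFinset.sup id),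
        Nat.lt_succ_of_le (min_le_right _ _)⟩)} : ℝ) /
    (Nat.card G : ℝ) ^ (φ.freeVarFinset.sup id + 1)

/-- `BA(X)`, the Boolean algebra generated by a fragment `X`: the closure of `X` under
`∨`, `∧` and `¬`. -/
inductive InBA {L : Language} (X : Set (L.Formula ℕ)) : L.Formula ℕ → Prop
  | base {φ : L.Formula ℕ} : φ ∈ X → InBA X φ
  | sup {φ ψ : L.Formula ℕ} : InBA X φ → InBA X ψ → InBA X (φ ⊔ ψ)
  | inf {φ ψ : L.Formula ℕ} : InBA X φ → InBA X ψ → InBA X (φ ⊓ ψ)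
  | not {φ : L.Formula ℕ} : InBA X φ → InBA X φ.not

/-- Average of a function of an infinite tuple over the tuples determined by `N + 1` entries. -/
noncomputable def avgN {A : Type*} [Fintype A] (N : ℕ) (f : (ℕ → A) → ℝ) : ℝ :=
  (∑ v : Fin (N + 1) → A, f (fun k => v ⟨min k N, Nat.lt_succ_of_le (min_le_right _ _)⟩)) /
    (Nat.card A : ℝ) ^ (N + 1)

lemma avgN_step {A : Type*} [Fintype A] [Nonempty A] (s N : ℕ) (hN : s ≤ N) (f : (ℕ → A) → ℝ)
    (hf : ∀ x y : ℕ → A, (∀ k ≤ s, x k = y k) → f x = f y) :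
    avgN (N + 1) f = avgN N f := by
  have hA : (Nat.card A : ℝ) ≠ 0 := by
    exact_mod_cast (Nat.card_pos (α := A)).ne'
  have key : (∑ v : Fin (N + 1 + 1) → A,
      f (fun k => v ⟨min k (N + 1), Nat.lt_succ_of_le (min_le_right _ _)⟩)) =
      (Nat.card A : ℝ) * ∑ v : Fin (N + 1) → A,
        f (fun k => v ⟨min k N, Nat.lt_succ_of_le (min_le_right _ _)⟩) := by
    rw [← Equiv.sum_comp (Fin.snocEquiv (fun _ : Fin (N + 1 + 1) => A)), Fintype.sum_prod_type]
    have : ∀ (a : A) (v : Fin (N + 1) → A),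
        f (fun k => (Fin.snocEquiv (fun _ : Fin (N + 1 + 1) => A)) (a, v)
          ⟨min k (N + 1), Nat.lt_succ_of_le (min_le_right _ _)⟩) =
        f (fun k => v ⟨min k N, Nat.lt_succ_of_le (min_le_right _ _)⟩) := by
      intro a v
      apply hf
      intro k hk
      have h1 : (⟨min k (N + 1), Nat.lt_succ_of_le (min_le_right _ _)⟩ : Fin (N + 1 + 1)) =
          Fin.castSucc ⟨min k N, Nat.lt_succ_of_le (min_le_right _ _)⟩ := by
        ext
        simp
        omega
      rw [h1]
      exact Fin.snoc_castSucc (α := fun _ => A) a v _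
    simp only [this]
    simp [Nat.card_eq_fintype_card]
  unfold avgN
  rw [key, pow_succ _ (N + 1)]
  field_simp

lemma avgN_eq {A : Type*} [Fintype A] [Nonempty A] (s N : ℕ) (hN : s ≤ N) (f : (ℕ → A) → ℝ)
    (hf : ∀ x y : ℕ → A, (∀ k ≤ s, x k = y k) → f x = f y) :
    avgN N f = avgN s f := by
  induction N, hN using Nat.le_induction with
  | base => rfl
  | succ n hn ih => rw [avgN_step s n hn f hf, ih]

open Classical in
/-- Indicator function of a formula. -/
noncomputable def indF {L : Language} (φ : L.Formula ℕ) (A : Type*) [L.Structure A]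
    (v : ℕ → A) : ℝ := if φ.Realize v then 1 else 0

lemma indF_local {L : Language} (φ : L.Formula ℕ) (A : Type*) [L.Structure A]
    (x y : ℕ → A) (h : ∀ k ≤ φ.freeVarFinset.sup id, x k = y k) :
    indF φ A x = indF φ A y := by
  have : φ.Realize x ↔ φ.Realize y := by
    unfold Language.Formula.Realize
    rw [← Language.BoundedFormula.realize_restrictFreeVar (φ := φ) (f := fun a => (a : ℕ)) (v := x) x
      (fun _ => rfl)]
    rw [Language.BoundedFormula.realize_restrictFreeVar (φ := φ) (f := fun a => (a : ℕ)) (v := x) y]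
    intro a
    exact h a (Finset.le_sup (f := id) a.2)
  unfold indF
  by_cases hx : φ.Realize x
  · rw [if_pos hx, if_pos (this.1 hx)]
  · rw [if_neg hx, if_neg (fun hy => hx (this.2 hy))]

lemma densN_eq_avgN {L : Language} (φ : L.Formula ℕ) (A : Type*) [L.Structure A] [Fintype A]
    [Nonempty A] (N : ℕ) (hN : φ.freeVarFinset.sup id ≤ N) :
    densN φ A = avgN N (indF φ A) := by
  classical
  rw [avgN_eq _ N hN _ (indF_local φ A)]
  unfold densN avgN
  congr 1
  simp only [indF]
  rw [Finset.sum_boole, Nat.card_eq_fintype_card, Fintype.card_subtype]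

/-- Let `X` be a fragment of `FO(L)` closed under finite conjunction (a meet
semilattice of `FO(L)`) and let `BA(X)` be the Boolean algebra generated by `X` (the closure of
`X` under `∨`, `∧`, `¬`). Then a sequence `(G n)` of finite `L`-structures is `X`-convergent
if and only if it is `BA(X)`-convergent. -/
theorem X_convergence_iff_BA_convergence (L : Language) [L.IsRelational]
    [Finite (Σ n, L.Relations n)] (X : Set (L.Formula ℕ))
    (hmeet : ∀ φ ∈ X, ∀ ψ ∈ X, φ ⊓ ψ ∈ X)
    (G : ℕ → FinStruct L) :
    (∀ φ ∈ X, ∃ ℓ : ℝ, Tendsto (fun n => densN φ (G n).carrier) atTop (nhds ℓ)) ↔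
    (∀ φ : L.Formula ℕ, InBA X φ →
      ∃ ℓ : ℝ, Tendsto (fun n => densN φ (G n).carrier) atTop (nhds ℓ)) := by
  classical
  constructor
  swap
  · intro h φ hφ
    exact h φ (InBA.base hφ)
  intro hX φ hφ
  let _ : ∀ n, Fintype (G n).carrier := fun n => Fintype.ofFinite _
  let ind : L.Formula ℕ → (Σ n, ℕ → (G n).carrier) → ℝ := fun φ p => indF φ (G p.1).carrier p.2
  let S : Set ((Σ n, ℕ → (G n).carrier) → ℝ) := ind '' X
  have ind_inf : ∀ φ ψ, ind (φ ⊓ ψ) = ind φ * ind ψ := by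
    intro φ ψ
    funext p
    simp only [ind, indF, Pi.mul_apply, Language.Formula.realize_inf]
    by_cases h1 : φ.Realize p.2 <;> by_cases h2 : ψ.Realize p.2 <;> simp [h1, h2]
  have ind_sup : ∀ φ ψ, ind (φ ⊔ ψ) = ind φ + ind ψ - ind φ * ind ψ := by
    intro φ ψ
    funext p
    simp only [ind, indF, Pi.mul_apply, Pi.add_apply, Pi.sub_apply, Language.Formula.realize_sup]
    by_cases h1 : φ.Realize p.2 <;> by_cases h2 : ψ.Realize p.2 <;> simp [h1, h2]
  have ind_not : ∀ φ, ind φ.not = 1 - ind φ := by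
    intro φ
    funext p
    simp only [ind, indF, Pi.one_apply, Pi.sub_apply, Language.Formula.realize_not]
    by_cases h1 : φ.Realize p.2 <;> simp [h1]
  have hadj : ind φ ∈ Algebra.adjoin ℝ S := by
    induction hφ with
    | base h => exact Algebra.subset_adjoin ⟨_, h, rfl⟩
    | sup _ _ h1 h2 => rw [ind_sup]; exact sub_mem (add_mem h1 h2) (mul_mem h1 h2)
    | inf _ _ h1 h2 => rw [ind_inf]; exact mul_mem h1 h2
    | not _ h => rw [ind_not]; exact sub_mem (one_mem _) h
  have hclos : ∀ f ∈ Submonoid.closure S, f = 1 ∨ f ∈ S := by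
    intro f hf
    induction hf using Submonoid.closure_induction with
    | mem x hx => exact Or.inr hx
    | one => exact Or.inl rfl
    | mul x y _ _ hx hy =>
      rcases hx with rfl | ⟨a, ha, rfl⟩
      · simpa using hy
      · rcases hy with rfl | ⟨b, hb, rfl⟩
        · exact Or.inr ⟨a, ha, by simp⟩
        · exact Or.inr ⟨a ⊓ b, hmeet a ha b hb, ind_inf a b⟩
  have hspan : ind φ ∈ Submodule.span ℝ (Submonoid.closure S : Set ((Σ n, ℕ → (G n).carrier) → ℝ)) := by
    rw [← Algebra.adjoin_eq_span]
    exact hadj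
  have hconv : ∀ f ∈ Submodule.span ℝ (Submonoid.closure S : Set ((Σ n, ℕ → (G n).carrier) → ℝ)),
      ∃ N₀ : ℕ, ∀ N ≥ N₀, ∃ ℓ : ℝ,
        Tendsto (fun n => avgN N (fun v : ℕ → (G n).carrier => f ⟨n, v⟩)) atTop (nhds ℓ) := by
    intro f hf
    induction hf using Submodule.span_induction with
    | mem x hx =>
      rcases hclos x hx with rfl | ⟨a, ha, rfl⟩
      · refine ⟨0, fun N _ => ⟨1, ?_⟩⟩
        have : ∀ n, avgN N (fun v : ℕ → (G n).carrier => (1 : (Σ n, ℕ → (G n).carrier) → ℝ) ⟨n, v⟩)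
            = 1 := by
          intro n
          have hA : (Fintype.card (G n).carrier : ℝ) ≠ 0 := by
            exact_mod_cast Fintype.card_ne_zero
          simp [avgN, hA]
        simp only [this]
        exact tendsto_const_nhds
      · refine ⟨a.freeVarFinset.sup id, fun N hN => ?_⟩
        obtain ⟨ℓ, hℓ⟩ := hX a ha
        refine ⟨ℓ, hℓ.congr fun n => ?_⟩
        exact densN_eq_avgN a (G n).carrier N hN
    | zero => exact ⟨0, fun N _ => ⟨0, by simp [avgN]⟩⟩
    | add x y _ _ hx hy =>
      obtain ⟨N₁, h1⟩ := hx
      obtain ⟨N₂, h2⟩ := hy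
      refine ⟨max N₁ N₂, fun N hN => ?_⟩
      obtain ⟨a, ha⟩ := h1 N (le_trans (le_max_left _ _) hN)
      obtain ⟨b, hb⟩ := h2 N (le_trans (le_max_right _ _) hN)
      refine ⟨a + b, (ha.add hb).congr fun n => ?_⟩
      simp [avgN, Finset.sum_add_distrib, add_div]
    | smul c x _ hx =>
      obtain ⟨N₁, h1⟩ := hx
      refine ⟨N₁, fun N hN => ?_⟩
      obtain ⟨a, ha⟩ := h1 N hN
      refine ⟨c * a, (ha.const_mul c).congr fun n => ?_⟩
      simp [avgN, ← Finset.mul_sum, mul_div_assoc]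
  obtain ⟨N₀, h⟩ := hconv _ hspan
  obtain ⟨ℓ, hℓ⟩ := h (max N₀ (φ.freeVarFinset.sup id)) (le_max_left _ _)
  refine ⟨ℓ, hℓ.congr fun n => ?_⟩
  exact (densN_eq_avgN φ (G n).carrier _ (le_max_right _ _)).symm
end

section
/- Let (G_n) be a sequence of finite graphs. Then (G_n) is FO-convergent if and only if it is both FO^local-convergent and elementarily convergent. -/
open FirstOrder Filter

/-- A finite nonempty graph (bundled). -/
structure FinGraph where
  V : Type
  graph : SimpleGraph V
  [fin : Fintype V]
  [nonempty : Nonempty V]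

attribute [instance] FinGraph.fin FinGraph.nonempty

/-- The density `⟨φ,G⟩` of a first-order formula `φ` of the language of graphs with `p` free
variables in a finite graph `G`: the proportion of `p`-tuples of vertices satisfying `φ`. -/
noncomputable def gDens {V : Type} (G : SimpleGraph V) {p : ℕ}
    (φ : Language.graph.Formula (Fin p)) : ℝ :=
  haveI := G.structure
  (Nat.card {v : Fin p → V // φ.Realize v} : ℝ) / (Nat.card V : ℝ) ^ p

/-- Satisfaction of a first-order sentence in a graph. -/
def gSat {V : Type} (G : SimpleGraph V) (φ : Language.graph.Sentence) : Prop :=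
  haveI := G.structure
  Language.Sentence.Realize V φ

/-- The set of vertices at distance at most `r` from the set `S` in the graph `G`
(the closed `r`-neighborhood `N_r(S)`). -/
def ballSet {V : Type} (G : SimpleGraph V) (r : ℕ) (S : Set V) : Set V :=
  {u | ∃ s ∈ S, ∃ w : G.Walk s u, w.length ≤ r}

/-- Realization of a formula of the language of graphs in a graph. -/
def gRealize {V : Type} (G : SimpleGraph V) {p : ℕ} (φ : Language.graph.Formula (Fin p))
    (v : Fin p → V) : Prop :=
  haveI := G.structure
  φ.Realize v

/-- A formula `φ(x₁,…,x_p)` is `r`-local if for every graph `G` and every tuple `v`,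
`G ⊨ φ(v)` holds iff `φ(v)` holds in the subgraph of `G` induced by the closed
`r`-neighborhood of `{v₁,…,v_p}`. -/
def IsLocalFormula (r : ℕ) {p : ℕ} (φ : Language.graph.Formula (Fin p)) : Prop :=
  ∀ (V : Type) (G : SimpleGraph V) (v : Fin p → V),
    gRealize G φ v ↔
      gRealize (G.induce (ballSet G r (Set.range v))) φ
        (fun i => ⟨v i, v i, Set.mem_range_self i, SimpleGraph.Walk.nil, Nat.zero_le r⟩)

/-- `FO`-convergence: the densities of all first-order formulas converge. -/
def FOConv (Gs : ℕ → FinGraph) : Prop :=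
  ∀ (p : ℕ) (φ : Language.graph.Formula (Fin p)),
    ∃ ℓ : ℝ, Tendsto (fun n => gDens (Gs n).graph φ) atTop (nhds ℓ)

/-- `FO^local`-convergence: the densities of all local formulas converge. -/
def FOLocalConv (Gs : ℕ → FinGraph) : Prop :=
  ∀ (p r : ℕ) (φ : Language.graph.Formula (Fin p)), IsLocalFormula r φ →
    ∃ ℓ : ℝ, Tendsto (fun n => gDens (Gs n).graph φ) atTop (nhds ℓ)

/-- Elementary convergence: for every sentence `φ`, eventually either all graphs of the
sequence satisfy `φ` or none of them does. -/
def ElemConv (Gs : ℕ → FinGraph) : Prop :=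
  ∀ φ : Language.graph.Sentence, ∃ N : ℕ,
    (∀ n ≥ N, gSat (Gs n).graph φ) ∨ (∀ n ≥ N, ¬ gSat (Gs n).graph φ)

namespace Gaif

/-- Own syntax for first-order formulas of graphs, with free variables in `X`. -/
inductive F : Type → Type 1
  | fls {X : Type} : F X
  | eq {X : Type} (i j : X) : F X
  | adj {X : Type} (i j : X) : F X
  | not {X : Type} (f : F X) : F X
  | and {X : Type} (f g : F X) : F X
  | ex {X : Type} (f : F (Option X)) : F X

/-- Extend an assignment by one value. -/
def ext {X V : Type} (v : X → V) (y : V) : Option X → V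
  | none => y
  | some x => v x

@[simp] theorem ext_none {X V : Type} (v : X → V) (y : V) : ext v y none = y := rfl
@[simp] theorem ext_some {X V : Type} (v : X → V) (y : V) (x : X) : ext v y (some x) = v x := rfl

/-- Satisfaction with quantifiers relativized to `S`. -/
def Sat {V : Type} (G : SimpleGraph V) (S : Set V) : {X : Type} → F X → (X → V) → Prop
  | _, .fls, _ => False
  | _, .eq i j, v => v i = v j
  | _, .adj i j, v => G.Adj (v i) (v j)
  | _, .not f, v => ¬ Sat G S f v
  | _, .and f g, v => Sat G S f v ∧ Sat G S g v
  | _, .ex f, v => ∃ y ∈ S, Sat G S f (ext v y)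

def F.or {X : Type} (f g : F X) : F X := .not (.and (.not f) (.not g))

@[simp] theorem sat_or {V X : Type} (G : SimpleGraph V) (S : Set V) (f g : F X) (v : X → V) :
    Sat G S (f.or g) v ↔ Sat G S f v ∨ Sat G S g v := by
  simp only [F.or, Sat]; tauto

theorem reindex {X : Type} (f : F X) : ∀ {Y : Type} (e : X → Y), ∃ g : F Y,
    ∀ (V : Type) (G : SimpleGraph V) (S : Set V) (v : Y → V),
      Sat G S g v ↔ Sat G S f (v ∘ e) := by
  induction f with
  | fls => intro Y e; exact ⟨.fls, by simp [Sat]⟩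
  | eq i j => intro Y e; exact ⟨.eq (e i) (e j), by simp [Sat]⟩
  | adj i j => intro Y e; exact ⟨.adj (e i) (e j), by simp [Sat]⟩
  | not f ih =>
    intro Y e
    obtain ⟨g, hg⟩ := ih e
    exact ⟨.not g, by simp [Sat, hg]⟩
  | and f1 f2 ih1 ih2 =>
    intro Y e
    obtain ⟨g1, hg1⟩ := ih1 e
    obtain ⟨g2, hg2⟩ := ih2 e
    exact ⟨.and g1 g2, by simp [Sat, hg1, hg2]⟩
  | ex f ih =>
    intro Y e
    obtain ⟨g, hg⟩ := ih (Option.map e)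
    refine ⟨.ex g, fun V G S v => ?_⟩
    have : ∀ y, ext v y ∘ Option.map e = ext (v ∘ e) y := by
      intro y; funext o; cases o <;> rfl
    simp only [Sat, hg, this]

/-- finite disjunction -/
theorem disj {X ι : Type} (l : List ι) (f : ι → F X) : ∃ g : F X,
    ∀ (V : Type) (G : SimpleGraph V) (S : Set V) (v : X → V),
      Sat G S g v ↔ ∃ i ∈ l, Sat G S (f i) v := by
  induction l with
  | nil => exact ⟨.fls, by simp [Sat]⟩
  | cons a l ih =>
    obtain ⟨g, hg⟩ := ih
    exact ⟨(f a).or g, by simp [hg]⟩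

theorem disjFin {X ι : Type} [Finite ι] (f : ι → F X) : ∃ g : F X,
    ∀ (V : Type) (G : SimpleGraph V) (S : Set V) (v : X → V),
      Sat G S g v ↔ ∃ i, Sat G S (f i) v := by
  have := Fintype.ofFinite ι
  obtain ⟨g, hg⟩ := disj (Finset.univ : Finset ι).toList f
  exact ⟨g, by simpa using hg⟩

theorem conjFin {X ι : Type} [Finite ι] (f : ι → F X) : ∃ g : F X,
    ∀ (V : Type) (G : SimpleGraph V) (S : Set V) (v : X → V),
      Sat G S g v ↔ ∀ i, Sat G S (f i) v := by
  obtain ⟨g, hg⟩ := disjFin (fun i => (f i).not)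
  exact ⟨g.not, by simp [Sat, hg]⟩

theorem exFin (k : ℕ) : ∀ {X : Type} (f : F (X ⊕ Fin k)), ∃ g : F X,
    ∀ (V : Type) (G : SimpleGraph V) (S : Set V) (v : X → V),
      Sat G S g v ↔ ∃ y : Fin k → V, (∀ i, y i ∈ S) ∧ Sat G S f (Sum.elim v y) := by
  induction k with
  | zero =>
    intro X f
    obtain ⟨g, hg⟩ := reindex f (Sum.elim id Fin.elim0)
    refine ⟨g, fun V G S v => ?_⟩
    rw [hg]
    have : ∀ y : Fin 0 → V, v ∘ Sum.elim id Fin.elim0 = Sum.elim v y := by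
      intro y; funext o; rcases o with o | o
      · rfl
      · exact o.elim0
    constructor
    · intro h
      exact ⟨Fin.elim0, fun i => i.elim0, this _ ▸ h⟩
    · rintro ⟨y, -, h⟩
      exact this y ▸ h
  | succ k ih =>
    intro X f
    obtain ⟨g, hg⟩ := reindex f (Y := Option X ⊕ Fin k)
      (Sum.elim (fun x => Sum.inl (some x)) (Fin.cases (Sum.inl none) Sum.inr))
    obtain ⟨h, hh⟩ := ih g
    refine ⟨.ex h, fun V G S v => ?_⟩
    simp only [Sat, hh, hg]
    have key : ∀ (y0 : V) (y : Fin k → V), Sum.elim (ext v y0) y ∘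
        (Sum.elim (fun x => Sum.inl (some x)) (Fin.cases (Sum.inl none) Sum.inr))
        = Sum.elim v (Fin.cons y0 y : Fin (k+1) → V) := by
      intro y0 y; funext o; rcases o with o | o
      · rfl
      · refine Fin.cases ?_ (fun i => ?_) o <;> rfl
    simp only [key]
    constructor
    · rintro ⟨y0, h0, y, hy, H⟩
      exact ⟨Fin.cons y0 y, fun i => Fin.cases h0 hy i, H⟩
    · rintro ⟨y, hy, H⟩
      refine ⟨y 0, hy 0, Fin.tail y, fun i => hy _, ?_⟩
      rwa [Fin.cons_self_tail]

/-- distance at most `m` -/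
def D {V : Type} (G : SimpleGraph V) (m : ℕ) (x y : V) : Prop := ∃ w : G.Walk x y, w.length ≤ m

theorem D_refl {V : Type} (G : SimpleGraph V) (m : ℕ) (x : V) : D G m x x :=
  ⟨.nil, Nat.zero_le _⟩

theorem D_symm {V : Type} {G : SimpleGraph V} {m : ℕ} {x y : V} (h : D G m x y) : D G m y x := by
  obtain ⟨w, hw⟩ := h; exact ⟨w.reverse, by simpa using hw⟩

theorem D_trans {V : Type} {G : SimpleGraph V} {m k : ℕ} {x y z : V} (h : D G m x y)
    (h' : D G k y z) : D G (m + k) x z := by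
  obtain ⟨w, hw⟩ := h; obtain ⟨w', hw'⟩ := h'
  exact ⟨w.append w', by rw [SimpleGraph.Walk.length_append]; omega⟩

theorem D_mono {V : Type} {G : SimpleGraph V} {m k : ℕ} {x y : V} (h : D G m x y)
    (hk : m ≤ k) : D G k x y := by
  obtain ⟨w, hw⟩ := h; exact ⟨w, hw.trans hk⟩

theorem D_adj {V : Type} {G : SimpleGraph V} {x y : V} (h : G.Adj x y) : D G 1 x y :=
  ⟨.cons h .nil, by simp⟩

theorem D_zero {V : Type} {G : SimpleGraph V} {x y : V} : D G 0 x y ↔ x = y := by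
  constructor
  · rintro ⟨w, hw⟩; exact SimpleGraph.Walk.eq_of_length_eq_zero (Nat.le_zero.1 hw)
  · rintro rfl; exact D_refl _ _ _

theorem D_succ {V : Type} {G : SimpleGraph V} {m : ℕ} {x y : V} :
    D G (m + 1) x y ↔ ∃ z, (x = z ∨ G.Adj x z) ∧ D G m z y := by
  constructor
  · rintro ⟨w, hw⟩
    cases w with
    | nil => exact ⟨x, Or.inl rfl, D_refl _ _ _⟩
    | cons h w => exact ⟨_, Or.inr h, w, by simpa using hw⟩
  · rintro ⟨z, rfl | h, h'⟩
    · exact D_mono h' (Nat.le_succ _)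
    · rw [add_comm]; exact D_trans (D_adj h) h'

def ball {V X : Type} (G : SimpleGraph V) (r : ℕ) (v : X → V) : Set V := {u | ∃ i, D G r (v i) u}

theorem ball_mono {V X : Type} {G : SimpleGraph V} {r s : ℕ} (h : r ≤ s) (v : X → V) :
    ball G r v ⊆ ball G s v := fun _ ⟨i, hi⟩ => ⟨i, D_mono hi h⟩

theorem ball_comp {V X Y : Type} {G : SimpleGraph V} {r : ℕ} (v : X → V) (e : Y → X) :
    ball G r (v ∘ e) ⊆ ball G r v := fun _ ⟨i, hi⟩ => ⟨e i, hi⟩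

theorem near (m : ℕ) : ∀ {X : Type} (i j : X), ∃ f : F X,
    ∀ (V : Type) (G : SimpleGraph V) (S : Set V) (v : X → V),
      {u | D G m (v i) u} ⊆ S → (Sat G S f v ↔ D G m (v i) (v j)) := by
  induction m with
  | zero => intro X i j; exact ⟨.eq i j, by simp [Sat, D_zero]⟩
  | succ m ih =>
    intro X i j
    obtain ⟨f, hf⟩ := ih (none : Option X) (some j)
    refine ⟨.ex (.and (F.or (.eq (some i) none) (.adj (some i) none)) f), fun V G S v hS => ?_⟩
    simp only [Sat, sat_or, ext_none, ext_some]
    rw [D_succ]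
    constructor
    · rintro ⟨z, hz, h, h'⟩
      refine ⟨z, h, (hf V G S (ext v z) ?_).1 h'⟩
      intro u hu; exact hS (D_succ.2 ⟨z, h, hu⟩)
    · rintro ⟨z, h, h'⟩
      refine ⟨z, hS (D_succ.2 ⟨z, h, D_refl _ _ _⟩), h, (hf V G S (ext v z) ?_).2 h'⟩
      intro u hu; exact hS (D_succ.2 ⟨z, h, hu⟩)

theorem nearBall (m : ℕ) {X Z : Type} [Finite X] (c : X → Z) (j : Z) : ∃ f : F Z,
    ∀ (V : Type) (G : SimpleGraph V) (S : Set V) (v : Z → V),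
      ball G m (v ∘ c) ⊆ S → (Sat G S f v ↔ v j ∈ ball G m (v ∘ c)) := by
  choose f hf using fun i : X => near m (c i) j
  obtain ⟨g, hg⟩ := disjFin f
  refine ⟨g, fun V G S v hS => ?_⟩
  rw [hg]
  refine exists_congr fun i => hf i V G S v (fun u hu => hS ⟨i, hu⟩)

/-- relativization to a ball -/
theorem relat (r : ℕ) {X : Type} [Finite X] {Z : Type} (f : F Z) : ∀ (c : X → Z), ∃ g : F Z,
    ∀ (V : Type) (G : SimpleGraph V) (S : Set V) (v : Z → V),
      ball G r (v ∘ c) ⊆ S → (Sat G S g v ↔ Sat G (ball G r (v ∘ c)) f v) := by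
  induction f with
  | fls => intro c; exact ⟨.fls, by simp [Sat]⟩
  | eq i j => intro c; exact ⟨.eq i j, by simp [Sat]⟩
  | adj i j => intro c; exact ⟨.adj i j, by simp [Sat]⟩
  | not f ih =>
    intro c
    obtain ⟨g, hg⟩ := ih c
    exact ⟨.not g, fun V G S v h => by simp [Sat, hg V G S v h]⟩
  | and f1 f2 ih1 ih2 =>
    intro c
    obtain ⟨g1, hg1⟩ := ih1 c
    obtain ⟨g2, hg2⟩ := ih2 c
    exact ⟨.and g1 g2, fun V G S v h => by simp [Sat, hg1 V G S v h, hg2 V G S v h]⟩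
  | ex f ih =>
    intro c
    obtain ⟨g, hg⟩ := ih (some ∘ c)
    obtain ⟨b, hb⟩ := nearBall r (some ∘ c) none
    refine ⟨.ex (.and b g), fun V G S v h => ?_⟩
    simp only [Sat]
    have e : ∀ y, ext v y ∘ (some ∘ c) = v ∘ c := fun y => rfl
    constructor
    · rintro ⟨y, hy, h1, h2⟩
      have h1 := (hb V G S (ext v y) h).1 h1
      exact ⟨y, h1, (hg V G S (ext v y) h).1 h2⟩
    · rintro ⟨y, hy, h2⟩
      exact ⟨y, h hy, (hb V G S (ext v y) h).2 hy, (hg V G S (ext v y) h).2 h2⟩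

/-- Feferman-Vaught for two separated parts. -/
theorem fv {Z : Type} (f : F Z) : ∀ {X Y : Type} (e : Z → X ⊕ Y), ∃ L : List (F X × F Y),
    ∀ (V : Type) (G : SimpleGraph V) (S T : Set V) (a : X → V) (b : Y → V),
      (∀ s ∈ S, ∀ t ∈ T, s ≠ t ∧ ¬ G.Adj s t) → (∀ x, a x ∈ S) → (∀ y, b y ∈ T) →
      (Sat G (S ∪ T) f (Sum.elim a b ∘ e) ↔ ∃ p ∈ L, Sat G S p.1 a ∧ Sat G T p.2 b) := by
  induction f with
  | fls => intro X Y e; exact ⟨[], by simp [Sat]⟩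
  | eq i j =>
    intro X Y e
    rcases hi : e i with x | x <;> rcases hj : e j with y | y
    · refine ⟨[(.eq x y, .not .fls)], ?_⟩; simp [Sat, hi, hj]
    · refine ⟨[], ?_⟩
      intro V G S T a b hST ha hb
      have := (hST _ (ha x) _ (hb y)).1
      simpa [Sat, hi, hj] using this
    · refine ⟨[], ?_⟩
      intro V G S T a b hST ha hb
      have := (hST _ (ha y) _ (hb x)).1.symm
      simpa [Sat, hi, hj] using this
    · refine ⟨[(.not .fls, .eq x y)], ?_⟩; simp [Sat, hi, hj]
  | adj i j =>
    intro X Y e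
    rcases hi : e i with x | x <;> rcases hj : e j with y | y
    · refine ⟨[(.adj x y, .not .fls)], ?_⟩; simp [Sat, hi, hj]
    · refine ⟨[], ?_⟩
      intro V G S T a b hST ha hb
      have := (hST _ (ha x) _ (hb y)).2
      simpa [Sat, hi, hj] using this
    · refine ⟨[], ?_⟩
      intro V G S T a b hST ha hb
      have := fun h => (hST _ (ha y) _ (hb x)).2 (SimpleGraph.Adj.symm h)
      simpa [Sat, hi, hj] using this
    · refine ⟨[(.not .fls, .adj x y)], ?_⟩; simp [Sat, hi, hj]
  | not f ih =>
    intro X Y e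
    obtain ⟨L, hL⟩ := ih e
    have neg : ∀ L : List (F X × F Y), ∃ L' : List (F X × F Y),
        ∀ (V : Type) (G : SimpleGraph V) (S T : Set V) (a : X → V) (b : Y → V),
        (¬ ∃ p ∈ L, Sat G S p.1 a ∧ Sat G T p.2 b) ↔ ∃ p ∈ L', Sat G S p.1 a ∧ Sat G T p.2 b := by
      intro L
      induction L with
      | nil => exact ⟨[(.not .fls, .not .fls)], by simp [Sat]⟩
      | cons q L ih =>
        obtain ⟨L', hL'⟩ := ih
        refine ⟨L'.map (fun p => (.and (.not q.1) p.1, p.2)) ++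
          L'.map (fun p => (p.1, .and (.not q.2) p.2)), fun V G S T a b => ?_⟩
        have := hL' V G S T a b
        have e1 : (¬ ∃ p ∈ q :: L, Sat G S p.1 a ∧ Sat G T p.2 b) ↔
          (¬ Sat G S q.1 a ∨ ¬ Sat G T q.2 b) ∧ ∃ p ∈ L', Sat G S p.1 a ∧ Sat G T p.2 b := by
          rw [← this]; simp only [List.exists_mem_cons_iff, not_or, not_and_or]
        rw [e1]
        constructor
        · rintro ⟨h | h, p, hp, h1, h2⟩
          · exact ⟨_, List.mem_append_left _ (List.mem_map.2 ⟨p, hp, rfl⟩), ⟨h, h1⟩, h2⟩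
          · exact ⟨_, List.mem_append_right _ (List.mem_map.2 ⟨p, hp, rfl⟩), h1, h, h2⟩
        · rintro ⟨pq, hpq, H1, H2⟩
          rcases List.mem_append.1 hpq with hpq | hpq
          · obtain ⟨p, hp, rfl⟩ := List.mem_map.1 hpq
            exact ⟨Or.inl H1.1, p, hp, H1.2, H2⟩
          · obtain ⟨p, hp, rfl⟩ := List.mem_map.1 hpq
            exact ⟨Or.inr H2.1, p, hp, H1, H2.2⟩
    obtain ⟨L', hL'⟩ := neg L
    refine ⟨L', fun V G S T a b h ha hb => ?_⟩
    rw [← hL', ← hL V G S T a b h ha hb]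
    rfl
  | and f1 f2 ih1 ih2 =>
    intro X Y e
    obtain ⟨L1, h1⟩ := ih1 e
    obtain ⟨L2, h2⟩ := ih2 e
    refine ⟨L1.flatMap fun p => L2.map fun q => (.and p.1 q.1, .and p.2 q.2),
      fun V G S T a b h ha hb => ?_⟩
    simp only [Sat, h1 V G S T a b h ha hb, h2 V G S T a b h ha hb]
    constructor
    · rintro ⟨⟨p, hp, a1, a2⟩, q, hq, b1, b2⟩
      exact ⟨(.and p.1 q.1, .and p.2 q.2), List.mem_flatMap.2 ⟨p, hp, List.mem_map.2 ⟨q, hq, rfl⟩⟩,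
        ⟨a1, b1⟩, a2, b2⟩
    · rintro ⟨pq, hpq, H1, H2⟩
      obtain ⟨p, hp, hpq⟩ := List.mem_flatMap.1 hpq
      obtain ⟨q, hq, rfl⟩ := List.mem_map.1 hpq
      exact ⟨⟨p, hp, H1.1, H2.1⟩, q, hq, H1.2, H2.2⟩
  | @ex Z f ih =>
    intro X Y e
    let e1 : Option Z → Option X ⊕ Y := fun o => match o with
      | none => Sum.inl none
      | some z => (e z).map some id
    let e2 : Option Z → X ⊕ Option Y := fun o => match o with
      | none => Sum.inr none
      | some z => (e z).map id some
    obtain ⟨L1, h1⟩ := ih e1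
    obtain ⟨L2, h2⟩ := ih e2
    refine ⟨L1.map (fun p => (.ex p.1, p.2)) ++ L2.map (fun p => (p.1, .ex p.2)),
      fun V G S T a b h ha hb => ?_⟩
    have k1 : ∀ y, ext (Sum.elim a b ∘ e) y = Sum.elim (ext a y) b ∘ e1 := by
      intro y; funext o
      rcases o with _ | z
      · rfl
      · simp only [ext_some, Function.comp, e1]; cases e z <;> rfl
    have k2 : ∀ y, ext (Sum.elim a b ∘ e) y = Sum.elim a (ext b y) ∘ e2 := by
      intro y; funext o
      rcases o with _ | z
      · rfl
      · simp only [ext_some, Function.comp, e2]; cases e z <;> rfl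
    have g1 : ∀ y ∈ S, ∀ x, ext a y x ∈ S := by
      intro y hy x; cases x; exacts [hy, ha _]
    have g2 : ∀ y ∈ T, ∀ x, ext b y x ∈ T := by
      intro y hy x; cases x; exacts [hy, hb _]
    constructor
    · rintro ⟨y, hy | hy, H⟩
      · rw [k1, h1 V G S T _ b h (g1 y hy) hb] at H
        obtain ⟨p, hp, H1, H2⟩ := H
        exact ⟨(.ex p.1, p.2), List.mem_append_left _ (List.mem_map.2 ⟨p, hp, rfl⟩),
          ⟨y, hy, H1⟩, H2⟩
      · rw [k2, h2 V G S T a _ h ha (g2 y hy)] at H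
        obtain ⟨p, hp, H1, H2⟩ := H
        exact ⟨(p.1, .ex p.2), List.mem_append_right _ (List.mem_map.2 ⟨p, hp, rfl⟩),
          H1, ⟨y, hy, H2⟩⟩
    · rintro ⟨pq, hpq, H1, H2⟩
      rcases List.mem_append.1 hpq with hpq | hpq
      · obtain ⟨p, hp, rfl⟩ := List.mem_map.1 hpq
        obtain ⟨y, hy, H1⟩ := H1
        refine ⟨y, Or.inl hy, ?_⟩
        rw [k1, h1 V G S T _ b h (g1 y hy) hb]
        exact ⟨p, hp, H1, H2⟩
      · obtain ⟨p, hp, rfl⟩ := List.mem_map.1 hpq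
        obtain ⟨y, hy, H2⟩ := H2
        refine ⟨y, Or.inr hy, ?_⟩
        rw [k2, h2 V G S T a _ h ha (g2 y hy)]
        exact ⟨p, hp, H1, H2⟩

/-- `f` is robust with radius `Q`: relativizing to any set containing the `Q`-ball is harmless. -/
def Rob {X : Type} (Q : ℕ) (f : F X) : Prop :=
  ∀ (V : Type) (G : SimpleGraph V) (S : Set V) (v : X → V), ball G Q v ⊆ S →
    (Sat G S f v ↔ Sat G Set.univ f v)

theorem Rob.mono {X : Type} {Q Q' : ℕ} {f : F X} (h : Rob Q f) (hQ : Q ≤ Q') : Rob Q' f :=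
  fun V G S v hS => h V G S v ((ball_mono hQ v).trans hS)

theorem Rob.not {X : Type} {Q : ℕ} {f : F X} (h : Rob Q f) : Rob Q f.not :=
  fun V G S v hS => not_congr (h V G S v hS)

theorem Rob.and {X : Type} {Q : ℕ} {f g : F X} (h : Rob Q f) (h' : Rob Q g) : Rob Q (f.and g) :=
  fun V G S v hS => and_congr (h V G S v hS) (h' V G S v hS)

theorem Rob.or {X : Type} {Q : ℕ} {f g : F X} (h : Rob Q f) (h' : Rob Q g) : Rob Q (f.or g) :=
  (h.not.and h'.not).not

theorem rob_fls {X : Type} (Q : ℕ) : Rob Q (F.fls : F X) := fun _ _ _ _ _ => Iff.rfl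

theorem bex {X : Type} [Finite X] {r : ℕ} (R : ℕ) {ψ : F (Option X)} (h : Rob r ψ) :
    ∃ γ : F X, Rob (R + r) γ ∧ ∀ (V : Type) (G : SimpleGraph V) (v : X → V),
      Sat G Set.univ γ v ↔ ∃ y ∈ ball G R v, Sat G Set.univ ψ (ext v y) := by
  obtain ⟨b, hb⟩ := nearBall R (some : X → Option X) none
  have key : ∀ (V : Type) (G : SimpleGraph V) (S : Set V) (v : X → V), ball G (R + r) v ⊆ S →
      (Sat G S (.ex (.and b ψ)) v ↔ ∃ y ∈ ball G R v, Sat G Set.univ ψ (ext v y)) := by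
    intro V G S v hS
    have hS' : ball G R v ⊆ S := (ball_mono (Nat.le_add_right _ _) v).trans hS
    have hh : ∀ y ∈ ball G R v, ball G r (ext v y) ⊆ S := by
      rintro y ⟨i, hi⟩ u ⟨j, hj⟩
      apply hS
      rcases j with _ | j
      · exact ⟨i, D_trans hi hj⟩
      · exact ⟨j, D_mono hj (Nat.le_add_left _ _)⟩
    constructor
    · rintro ⟨y, hy, h1, h2⟩
      have h1 := (hb V G S (ext v y) hS').1 h1
      exact ⟨y, h1, (h V G S _ (hh y h1)).1 h2⟩
    · rintro ⟨y, hy, h2⟩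
      exact ⟨y, hS' hy, (hb V G S (ext v y) hS').2 hy, (h V G S _ (hh y hy)).2 h2⟩
  exact ⟨_, fun V G S v hS => (key V G S v hS).trans (key V G _ v (Set.subset_univ _)).symm,
    fun V G v => key V G _ v (Set.subset_univ _)⟩

/-- `y` is a scattered family of points satisfying `β`. -/
def Scat {V : Type} (G : SimpleGraph V) (R : ℕ) (β : F Unit) {k : ℕ} (y : Fin k → V) : Prop :=
  (∀ i, Sat G Set.univ β (fun _ => y i)) ∧ ∀ i j, i ≠ j → ¬ D G (2 * R) (y i) (y j)

theorem scatFormula {X : Type} {r : ℕ} (R k : ℕ) {β : F Unit} (h : Rob r β) :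
    ∃ χ : F (X ⊕ Fin k), ∀ (V : Type) (G : SimpleGraph V) (S : Set V) (v : X → V) (y : Fin k → V),
      ball G (r + 2 * R) y ⊆ S → (Sat G S χ (Sum.elim v y) ↔ Scat G R β y) := by
  choose b hb using fun i : Fin k => reindex β (Y := X ⊕ Fin k) (fun _ => Sum.inr i)
  obtain ⟨B, hB⟩ := conjFin b
  choose d hd using fun p : {p : Fin k × Fin k // p.1 ≠ p.2} =>
    near (2 * R) (X := X ⊕ Fin k) (Sum.inr p.1.1) (Sum.inr p.1.2)
  obtain ⟨C, hC⟩ := conjFin (fun p => (d p).not)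
  refine ⟨B.and C, fun V G S v y hS => ?_⟩
  refine and_congr ?_ ?_
  · rw [hB]
    refine forall_congr' fun i => ?_
    rw [hb]
    refine h V G S _ ?_
    rintro u ⟨_, hu⟩
    exact hS ⟨i, D_mono hu (Nat.le_add_right _ _)⟩
  · rw [hC]
    have : ∀ p : {p : Fin k × Fin k // p.1 ≠ p.2}, Sat G S (d p) (Sum.elim v y) ↔
        D G (2 * R) (y p.1.1) (y p.1.2) := fun p => hd p V G S (Sum.elim v y)
          (fun u hu => hS ⟨p.1.1, D_mono hu (Nat.le_add_left _ _)⟩)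
    simp only [Sat, this]
    constructor
    · intro H i j hij; exact H ⟨(i, j), hij⟩
    · intro H p; exact H _ _ p.2

theorem scatSentence {r : ℕ} (R k : ℕ) {β : F Unit} (h : Rob r β) :
    ∃ σ : F Empty, ∀ (V : Type) (G : SimpleGraph V) (v : Empty → V),
      Sat G Set.univ σ v ↔ ∃ y : Fin k → V, Scat G R β y := by
  obtain ⟨χ, hχ⟩ := scatFormula (X := Empty) R k h
  obtain ⟨σ, hσ⟩ := exFin k χ
  refine ⟨σ, fun V G v => ?_⟩
  rw [hσ]
  refine exists_congr fun y => ?_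
  rw [hχ V G _ v y (Set.subset_univ _)]
  simp

theorem scatLocal {X : Type} [Finite X] {r : ℕ} (R k : ℕ) {β : F Unit} (h : Rob r β) :
    ∃ γ : F X, Rob (R + (r + 2 * R)) γ ∧ ∀ (V : Type) (G : SimpleGraph V) (v : X → V),
      Sat G Set.univ γ v ↔ ∃ y : Fin k → V, (∀ i, y i ∈ ball G R v) ∧ Scat G R β y := by
  obtain ⟨χ, hχ⟩ := scatFormula (X := X) R k h
  choose n hn using fun i : Fin k => nearBall R (Sum.inl : X → X ⊕ Fin k) (Sum.inr i)
  obtain ⟨N, hN⟩ := conjFin n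
  obtain ⟨γ, hγ⟩ := exFin k (N.and χ)
  have key : ∀ (V : Type) (G : SimpleGraph V) (S : Set V) (v : X → V),
      ball G (R + (r + 2 * R)) v ⊆ S →
      (Sat G S γ v ↔ ∃ y : Fin k → V, (∀ i, y i ∈ ball G R v) ∧ Scat G R β y) := by
    intro V G S v hS
    have hS' : ball G R v ⊆ S := (ball_mono (Nat.le_add_right _ _) v).trans hS
    rw [hγ]
    have e1 : ∀ y : Fin k → V, Sat G S N (Sum.elim v y) ↔ ∀ i, y i ∈ ball G R v := by
      intro y
      rw [hN]
      exact forall_congr' fun i => hn i V G S (Sum.elim v y) hS'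
    have e2 : ∀ y : Fin k → V, (∀ i, y i ∈ ball G R v) →
        (Sat G S χ (Sum.elim v y) ↔ Scat G R β y) := by
      intro y hy
      apply hχ
      rintro u ⟨i, hi⟩
      obtain ⟨x, hx⟩ := hy i
      exact hS ⟨x, D_trans hx hi⟩
    constructor
    · rintro ⟨y, hy, H1, H2⟩
      have H1 := (e1 y).1 H1
      exact ⟨y, H1, (e2 y H1).1 H2⟩
    · rintro ⟨y, hy, H⟩
      exact ⟨y, fun i => hS' (hy i), (e1 y).2 hy, (e2 y hy).2 H⟩
  exact ⟨_, fun V G S v hS => (key V G S v hS).trans (key V G _ v (Set.subset_univ _)).symm,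
    fun V G v => key V G _ v (Set.subset_univ _)⟩

/-- every sentence is eventually decided -/
def Dec (Gs : ℕ → FinGraph) : Prop := ∀ f : F Empty,
  (∀ᶠ n in atTop, Sat (Gs n).graph Set.univ f Empty.elim) ∨
  (∀ᶠ n in atTop, ¬ Sat (Gs n).graph Set.univ f Empty.elim)

theorem farLemma {Gs : ℕ → FinGraph} (hdec : Dec Gs) {X : Type} [Finite X] {r : ℕ} (R : ℕ)
    {β : F Unit} (h : Rob r β) :
    ∃ (Q : ℕ) (γ : F X), Rob Q γ ∧ ∀ᶠ n in atTop, ∀ v : X → (Gs n).V,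
      Sat (Gs n).graph Set.univ γ v ↔
        ∃ y, y ∉ ball (Gs n).graph R v ∧ Sat (Gs n).graph Set.univ β (fun _ => y) := by
  classical
  have hd : ∀ k : ℕ, (∀ᶠ n in atTop, ∃ y : Fin k → (Gs n).V, Scat (Gs n).graph R β y) ∨
      (∀ᶠ n in atTop, ¬ ∃ y : Fin k → (Gs n).V, Scat (Gs n).graph R β y) := by
    intro k
    obtain ⟨σ, hσ⟩ := scatSentence R k h
    have := hdec σ
    simpa only [hσ] using this
  by_cases hall : ∀ k : ℕ, ∀ᶠ n in atTop, ∃ y : Fin k → (Gs n).V, Scat (Gs n).graph R β y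
  · refine ⟨0, F.not .fls, (rob_fls 0).not, ?_⟩
    filter_upwards [hall (Nat.card X + 1)] with n hn v
    simp only [Sat, not_false_eq_true, true_iff]
    obtain ⟨y, hy⟩ := hn
    by_contra hcon
    push Not at hcon
    have : ∀ i, y i ∈ ball (Gs n).graph R v := fun i => by
      by_contra hi; exact hcon _ hi (hy.1 i)
    choose x hx using this
    have hinj : Function.Injective x := by
      intro i j hij
      by_contra hne
      refine hy.2 i j hne ?_
      rw [two_mul]
      refine D_trans (D_symm (hx i)) ?_
      rw [hij]; exact hx j
    have := Nat.card_le_card_of_injective x hinj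
    simp at this
  · rw [not_forall] at hall
    have hk := Nat.find_spec hall
    have hmin := fun m => Nat.find_min hall (m := m)
    generalize Nat.find hall = k at hk hmin
    obtain _ | k := k
    · exact absurd (Eventually.of_forall fun n =>
        ⟨(Fin.elim0 : Fin 0 → (Gs n).V), fun i => i.elim0, fun i => i.elim0⟩) hk
    have hk1 := (hd (k+1)).resolve_left hk
    have hk0 := not_not.1 (hmin k (Nat.lt_succ_self k))
    obtain ⟨γ1, r1, h1⟩ := scatLocal (X := X) R k h
    obtain ⟨b, hb⟩ := nearBall R (some : X → Option X) none
    obtain ⟨g, hg⟩ := reindex β (Y := Option X) (fun _ => none)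
    have hrob : Rob (r + R) (b.not.and g) := by
      apply Rob.and
      · apply Rob.not
        intro V G S v hS
        have : ball G R (v ∘ some) ⊆ S :=
          (ball_comp v some).trans ((ball_mono (Nat.le_add_left _ _) v).trans hS)
        rw [hb V G S v this, hb V G _ v (Set.subset_univ _)]
      · intro V G S v hS
        rw [hg, hg]
        exact h V G S _ ((ball_comp v _).trans ((ball_mono (Nat.le_add_right _ _) v).trans hS))
    obtain ⟨γ2, r2, h2⟩ := bex (3 * R) hrob
    refine ⟨R + (r + 2 * R) + (3 * R + (r + R)), γ1.not.or γ2,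
      (r1.not.mono (by omega)).or (r2.mono (by omega)), ?_⟩
    filter_upwards [hk0, hk1] with n hn0 hn1 v
    rw [sat_or, h2]
    simp only [Sat, h1]
    have e : ∀ y, (¬ Sat (Gs n).graph Set.univ b (ext v y) ∧ Sat (Gs n).graph Set.univ g (ext v y))
        ↔ (y ∉ ball (Gs n).graph R v ∧ Sat (Gs n).graph Set.univ β (fun _ => y)) := by
      intro y
      rw [hb _ _ _ _ (Set.subset_univ _), hg]
      rfl
    simp only [e]
    constructor
    · rintro (H | ⟨y, -, H⟩)
      · obtain ⟨y, hy⟩ := hn0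
        by_contra hcon
        push Not at hcon
        refine H ⟨y, fun i => ?_, hy⟩
        by_contra hi; exact hcon _ hi (hy.1 i)
      · exact ⟨y, H⟩
    · rintro ⟨z, hz, hzβ⟩
      by_cases H : ∃ y : Fin k → (Gs n).V, (∀ i, y i ∈ ball (Gs n).graph R v) ∧
          Scat (Gs n).graph R β y
      · right
        obtain ⟨y, hyb, hy⟩ := H
        refine ⟨z, ?_, hz, hzβ⟩
        by_contra hcon
        have hfar : ∀ i, ¬ D (Gs n).graph (2 * R) (y i) z := by
          intro i hi
          obtain ⟨x, hx⟩ := hyb i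
          exact hcon ⟨x, D_mono (D_trans hx hi) (by omega)⟩
        refine hn1 ⟨Fin.cons z y, fun i => ?_, fun i j => ?_⟩
        · refine Fin.cases ?_ (fun i => ?_) i
          · exact hzβ
          · exact hy.1 i
        · refine Fin.cases ?_ (fun i => ?_) i <;> refine Fin.cases ?_ (fun j => ?_) j
          · intro h; exact absurd rfl h
          · intro _ h; exact hfar j (D_symm h)
          · intro _ h; exact hfar i h
          · intro hij; exact hy.2 i j (fun h => hij (by rw [h]))
      · exact Or.inl H

theorem exStep {Gs : ℕ → FinGraph} (hdec : Dec Gs) {X : Type} [Finite X] {r : ℕ}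
    {ψ : F (Option X)} (h : Rob r ψ) :
    ∃ (Q : ℕ) (γ : F X), Rob Q γ ∧ ∀ᶠ n in atTop, ∀ v : X → (Gs n).V,
      Sat (Gs n).graph Set.univ γ v ↔ ∃ y, Sat (Gs n).graph Set.univ ψ (ext v y) := by
  obtain ⟨L, hL⟩ := fv ψ (X := X) (Y := Unit) (fun o => o.elim (Sum.inr ()) Sum.inl)
  -- the far part
  have far : ∀ L : List (F X × F Unit), ∃ (Q : ℕ) (γ : F X), Rob Q γ ∧ ∀ᶠ n in atTop,
      ∀ v : X → (Gs n).V, Sat (Gs n).graph Set.univ γ v ↔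
        ∃ y, y ∉ ball (Gs n).graph (2 * r + 1) v ∧ ∃ p ∈ L,
          Sat (Gs n).graph (ball (Gs n).graph r v) p.1 v ∧
          Sat (Gs n).graph (ball (Gs n).graph r (fun _ : Unit => y)) p.2 (fun _ => y) := by
    intro L
    induction L with
    | nil => exact ⟨0, .fls, rob_fls 0, by simp [Sat]⟩
    | cons q L ih =>
      obtain ⟨Q, γ, hQ, hγ⟩ := ih
      obtain ⟨α, hα⟩ := relat r q.1 (id : X → X)
      obtain ⟨β, hβ⟩ := relat r q.2 (id : Unit → Unit)
      have rα : Rob r α := fun V G S v hS => by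
        rw [hα V G S v hS, hα V G _ v (Set.subset_univ _)]
      have rβ : Rob r β := fun V G S v hS => by
        rw [hβ V G S v hS, hβ V G _ v (Set.subset_univ _)]
      obtain ⟨Q', δ, hQ', hδ⟩ := farLemma hdec (X := X) (2 * r + 1) rβ
      refine ⟨Q + r + Q', (α.and δ).or γ, Rob.or (Rob.and (rα.mono (by omega))
        (hQ'.mono (by omega))) (hQ.mono (by omega)), ?_⟩
      filter_upwards [hγ, hδ] with n h1 h2 v
      rw [sat_or, h1]
      simp only [Sat, h2, hα _ _ _ v (Set.subset_univ _), hβ _ _ _ _ (Set.subset_univ _),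
        List.exists_mem_cons_iff]
      constructor
      · rintro (⟨H1, y, hy, H2⟩ | ⟨y, hy, H⟩)
        · exact ⟨y, hy, Or.inl ⟨H1, H2⟩⟩
        · exact ⟨y, hy, Or.inr H⟩
      · rintro ⟨y, hy, ⟨H1, H2⟩ | H⟩
        · exact Or.inl ⟨H1, y, hy, H2⟩
        · exact Or.inr ⟨y, hy, H⟩
  obtain ⟨Q, γ, hQ, hγ⟩ := far L
  obtain ⟨δ, hδ, hδ'⟩ := bex (2 * r + 1) h
  refine ⟨Q + (2 * r + 1 + r), δ.or γ, (hδ.mono (by omega)).or (hQ.mono (by omega)), ?_⟩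
  filter_upwards [hγ] with n hn v
  rw [sat_or, hn, hδ']
  have key : ∀ y, y ∉ ball (Gs n).graph (2 * r + 1) v →
      (Sat (Gs n).graph Set.univ ψ (ext v y) ↔ ∃ p ∈ L,
          Sat (Gs n).graph (ball (Gs n).graph r v) p.1 v ∧
          Sat (Gs n).graph (ball (Gs n).graph r (fun _ : Unit => y)) p.2 (fun _ => y)) := by
    intro y hy
    have e1 : ext v y = Sum.elim v (fun _ : Unit => y) ∘
        (fun o : Option X => o.elim (Sum.inr ()) Sum.inl) := by
      funext o; cases o <;> rfl
    rw [← hL _ (Gs n).graph (ball (Gs n).graph r v) (ball (Gs n).graph r (fun _ : Unit => y)) v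
      (fun _ => y) ?_ (fun x => ⟨x, D_refl _ _ _⟩) (fun x => ⟨x, D_refl _ _ _⟩), ← e1]
    · symm
      apply h
      rintro u ⟨_ | x, hx⟩
      · exact Or.inr ⟨(), hx⟩
      · exact Or.inl ⟨x, hx⟩
    · rintro s ⟨x, hx⟩ t ⟨_, ht⟩
      constructor
      · rintro rfl
        exact hy ⟨x, D_mono (D_trans hx (D_symm ht)) (by omega)⟩
      · intro hadj
        exact hy ⟨x, D_mono (D_trans (D_trans hx (D_adj hadj)) (D_symm ht)) (by omega)⟩
  constructor
  · rintro (⟨y, -, H⟩ | ⟨y, hy, H⟩)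
    · exact ⟨y, H⟩
    · exact ⟨y, (key y hy).2 H⟩
  · rintro ⟨y, H⟩
    by_cases hy : y ∈ ball (Gs n).graph (2 * r + 1) v
    · exact Or.inl ⟨y, hy, H⟩
    · exact Or.inr ⟨y, hy, (key y hy).1 H⟩

/-- Weak Gaifman theorem along the sequence. -/
theorem gaifman {Gs : ℕ → FinGraph} (hdec : Dec Gs) {X : Type} (f : F X) : Finite X →
    ∃ (Q : ℕ) (γ : F X), Rob Q γ ∧ ∀ᶠ n in atTop, ∀ v : X → (Gs n).V,
      Sat (Gs n).graph Set.univ γ v ↔ Sat (Gs n).graph Set.univ f v := by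
  induction f with
  | fls => intro _; exact ⟨0, .fls, rob_fls 0, by simp⟩
  | eq i j => intro _; exact ⟨0, .eq i j, fun _ _ _ _ _ => Iff.rfl, by simp⟩
  | adj i j => intro _; exact ⟨0, .adj i j, fun _ _ _ _ _ => Iff.rfl, by simp⟩
  | not f ih =>
    intro hX
    obtain ⟨Q, γ, h1, h2⟩ := ih hX
    refine ⟨Q, γ.not, h1.not, ?_⟩
    filter_upwards [h2] with n hn v
    exact not_congr (hn v)
  | and f g ih1 ih2 =>
    intro hX
    obtain ⟨Q, γ, h1, h2⟩ := ih1 hX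
    obtain ⟨Q', γ', h1', h2'⟩ := ih2 hX
    refine ⟨Q + Q', γ.and γ', (h1.mono (by omega)).and (h1'.mono (by omega)), ?_⟩
    filter_upwards [h2, h2'] with n hn hn' v
    exact and_congr (hn v) (hn' v)
  | ex f ih =>
    intro hX
    obtain ⟨Q, γ, h1, h2⟩ := ih inferInstance
    obtain ⟨Q', γ', h1', h2'⟩ := exStep hdec h1
    refine ⟨Q', γ', h1', ?_⟩
    filter_upwards [h2, h2'] with n hn hn' v
    rw [hn']
    simp only [Sat, hn, Set.mem_univ, true_and]

theorem sat_induce {V : Type} (G : SimpleGraph V) (S : Set V) {X : Type} (f : F X) :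
    ∀ v : X → S, Sat G S f (fun x => (v x : V)) ↔ Sat (G.induce S) Set.univ f v := by
  induction f with
  | fls => intro v; rfl
  | eq i j => intro v; exact Subtype.ext_iff.symm
  | adj i j => intro v; simp [Sat]
  | not f ih => intro v; exact not_congr (ih v)
  | and f g ih1 ih2 => intro v; exact and_congr (ih1 v) (ih2 v)
  | ex f ih =>
    intro v
    have e : ∀ y : S, ext (fun x => (v x : V)) (y : V) = fun o => ((ext v y o : S) : V) := by
      intro y; funext o; cases o <;> rfl
    constructor
    · rintro ⟨y, hy, H⟩
      refine ⟨⟨y, hy⟩, trivial, (ih _).1 ?_⟩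
      rw [← e]; exact H
    · rintro ⟨y, -, H⟩
      refine ⟨y, y.2, ?_⟩
      rw [e]; exact (ih _).2 H

theorem toF {α : Type} {n : ℕ} (φ : Language.graph.BoundedFormula α n) :
    ∃ f : F (α ⊕ Fin n), ∀ (V : Type) (G : SimpleGraph V) (v : α → V) (xs : Fin n → V),
      Sat G Set.univ f (Sum.elim v xs) ↔
        @Language.BoundedFormula.Realize _ V G.structure α n φ v xs := by
  induction φ with
  | falsum => exact ⟨.fls, fun _ _ _ _ => Iff.rfl⟩
  | equal t₁ t₂ =>
    cases t₁ with
    | func f _ => exact Empty.elim f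
    | var i =>
    cases t₂ with
    | func f _ => exact Empty.elim f
    | var j => exact ⟨.eq i j, fun _ _ _ _ => Iff.rfl⟩
  | rel R ts =>
    cases R with
    | adj =>
    rcases h0 : ts 0 with i | f
    · rcases h1 : ts 1 with j | f
      · refine ⟨.adj i j, fun V G v xs => ?_⟩
        simp only [Sat, Language.BoundedFormula.Realize]
        change _ ↔ G.Adj _ _
        beta_reduce
        rw [h0, h1]
        rfl
      · exact Empty.elim (by assumption)
    · exact Empty.elim (by assumption)
  | imp φ ψ ih1 ih2 =>
    obtain ⟨f, hf⟩ := ih1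
    obtain ⟨g, hg⟩ := ih2
    refine ⟨f.not.or g, fun V G v xs => ?_⟩
    rw [sat_or]
    simp only [Sat, hf, hg, Language.BoundedFormula.Realize]
    tauto
  | @all n φ ih =>
    obtain ⟨f, hf⟩ := ih
    obtain ⟨g, hg⟩ := reindex f (Y := Option (α ⊕ Fin n)) (Sum.elim (fun a => some (Sum.inl a))
      (Fin.lastCases none (fun i => some (Sum.inr i))))
    refine ⟨(F.ex g.not).not, fun V G v xs => ?_⟩
    have e : ∀ y : V, ext (Sum.elim v xs) y ∘ (Sum.elim (fun a => some (Sum.inl a))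
      (Fin.lastCases none (fun i => some (Sum.inr i)))) =
        Sum.elim v (Fin.snoc xs y : Fin (n+1) → V) := by
      intro y; funext o; rcases o with o | o
      · rfl
      · refine Fin.lastCases ?_ (fun i => ?_) o <;> simp
    simp only [Sat, hg, e, hf, Language.BoundedFormula.Realize, Set.mem_univ, true_and, not_exists,
      not_not]

theorem fromF {X : Type} (f : F X) : ∃ φ : Language.graph.Formula X,
    ∀ (V : Type) (G : SimpleGraph V) (v : X → V),
      Sat G Set.univ f v ↔ @Language.Formula.Realize _ V G.structure X φ v := by
  induction f with
  | fls => exact ⟨⊥, fun _ _ _ => Iff.rfl⟩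
  | eq i j =>
    refine ⟨Language.Term.equal (.var i) (.var j), fun V G v => ?_⟩
    letI := G.structure
    simp [Sat, Language.Formula.realize_equal]
  | adj i j =>
    refine ⟨Language.Relations.formula₂ Language.adj (.var i) (.var j), fun V G v => ?_⟩
    letI := G.structure
    rw [Language.Formula.realize_rel₂]
    rfl
  | not f ih =>
    obtain ⟨φ, h⟩ := ih
    refine ⟨φ.not, fun V G v => ?_⟩
    letI := G.structure
    rw [Language.Formula.realize_not, ← h]
    rfl
  | and f g ih1 ih2 =>
    obtain ⟨φ, h⟩ := ih1
    obtain ⟨ψ, h'⟩ := ih2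
    refine ⟨φ ⊓ ψ, fun V G v => ?_⟩
    letI := G.structure
    rw [Language.Formula.realize_inf, ← h, ← h']
    rfl
  | @ex X f ih =>
    obtain ⟨φ, h⟩ := ih
    let e : Option X → X ⊕ Unit := fun o => o.elim (Sum.inr ()) Sum.inl
    refine ⟨(φ.relabel e).iExs Unit, fun V G v => ?_⟩
    letI := G.structure
    rw [Language.Formula.realize_iExs]
    simp only [Language.Formula.realize_relabel, ← h, Sat, Set.mem_univ, true_and]
    have k : ∀ y : V, Sum.elim v (fun _ : Unit => y) ∘ e = ext v y := by
      intro y; funext o; cases o <;> rfl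
    constructor
    · rintro ⟨y, H⟩
      refine ⟨fun _ => y, ?_⟩
      rw [k]; exact H
    · rintro ⟨y, H⟩
      refine ⟨y (), ?_⟩
      rw [← k]; exact H

theorem dec_of_elemConv {Gs : ℕ → FinGraph} (h : ElemConv Gs) : Dec Gs := by
  intro f
  obtain ⟨φ, hφ⟩ := fromF f
  obtain ⟨N, hN⟩ := h φ
  have key : ∀ n, gSat (Gs n).graph φ ↔ Sat (Gs n).graph Set.univ f Empty.elim := by
    intro n
    rw [hφ]
    unfold gSat Language.Sentence.Realize
    rw [Subsingleton.elim (default : Empty → (Gs n).V) Empty.elim]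
  simp only [key] at hN
  rcases hN with hN | hN
  · exact Or.inl (eventually_atTop.2 ⟨N, hN⟩)
  · exact Or.inr (eventually_atTop.2 ⟨N, hN⟩)

theorem ballSet_eq {V : Type} (G : SimpleGraph V) (r : ℕ) {p : ℕ} (v : Fin p → V) :
    ballSet G r (Set.range v) = ball G r v := by
  ext u
  simp [ballSet, ball, D]

theorem local_of_rob {p Q : ℕ} {γ : F (Fin p)} (h : Rob Q γ) {φ : Language.graph.Formula (Fin p)}
    (hφ : ∀ (V : Type) (G : SimpleGraph V) (v : Fin p → V),
      Sat G Set.univ γ v ↔ @Language.Formula.Realize _ V G.structure (Fin p) φ v) :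
    IsLocalFormula Q φ := by
  intro V G v
  unfold gRealize
  rw [← hφ, ← hφ, ← sat_induce]
  exact (h V G _ v (ballSet_eq G Q v).ge).symm

theorem gDens_congr {V : Type} (G : SimpleGraph V) {p : ℕ} (φ ψ : Language.graph.Formula (Fin p))
    (h : ∀ v, gRealize G φ v ↔ gRealize G ψ v) : gDens G φ = gDens G ψ := by
  unfold gDens
  have : ∀ v, @Language.Formula.Realize _ V G.structure (Fin p) φ v ↔
    @Language.Formula.Realize _ V G.structure (Fin p) ψ v := h
  simp only [this]

theorem fo_of_local {Gs : ℕ → FinGraph} (h1 : FOLocalConv Gs) (h2 : ElemConv Gs) : FOConv Gs := by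
  intro p φ
  obtain ⟨f, hf⟩ := toF φ
  obtain ⟨g, hg⟩ := reindex f (Sum.elim id Fin.elim0 : Fin p ⊕ Fin 0 → Fin p)
  have hg' : ∀ (V : Type) (G : SimpleGraph V) (v : Fin p → V),
      Sat G Set.univ g v ↔ gRealize G φ v := by
    intro V G v
    unfold gRealize Language.Formula.Realize
    rw [hg, ← hf]
    have : v ∘ (Sum.elim id Fin.elim0 : Fin p ⊕ Fin 0 → Fin p) = Sum.elim v default := by
      funext o; rcases o with o | o
      · rfl
      · exact o.elim0
    rw [this]
  obtain ⟨Q, γ, hQ, hγ⟩ := gaifman (dec_of_elemConv h2) g inferInstance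
  obtain ⟨ψ, hψ⟩ := fromF γ
  obtain ⟨ℓ, hℓ⟩ := h1 p Q ψ (local_of_rob hQ hψ)
  refine ⟨ℓ, hℓ.congr' ?_⟩
  filter_upwards [hγ] with n hn
  apply gDens_congr
  intro v
  rw [← hg', ← hn, hψ]
  rfl

theorem elem_of_fo {Gs : ℕ → FinGraph} (h : FOConv Gs) : ElemConv Gs := by
  classical
  intro φ
  obtain ⟨ℓ, hℓ⟩ := h 0 (Language.Formula.relabel (Empty.elim : Empty → Fin 0) φ)
  have key : ∀ n, gDens (Gs n).graph (Language.Formula.relabel (Empty.elim : Empty → Fin 0) φ) =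
      if gSat (Gs n).graph φ then 1 else 0 := by
    intro n
    unfold gDens gSat Language.Sentence.Realize
    have : ∀ v : Fin 0 → (Gs n).V, v ∘ (Empty.elim : Empty → Fin 0) = default :=
      fun v => Subsingleton.elim _ _
    simp only [Language.Formula.realize_relabel, this, pow_zero, div_one]
    split_ifs with hs
    · simp [hs]
    · simp [hs]
  simp only [key] at hℓ
  obtain ⟨N, hN⟩ := Metric.cauchySeq_iff.1 hℓ.cauchySeq 1 one_pos
  refine ⟨N, ?_⟩
  by_cases hs : gSat (Gs N).graph φ
  · left
    intro n hn
    by_contra hc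
    have := hN n hn N le_rfl
    simp [hs, hc] at this
  · right
    intro n hn hc
    have := hN n hn N le_rfl
    simp [hs, hc] at this

end Gaif

/-- A sequence of finite graphs is `FO`-convergent if and only if it is
both `FO^local`-convergent and elementarily convergent. -/
theorem foConv_iff_foLocalConv_and_elemConv (Gs : ℕ → FinGraph) :
    FOConv Gs ↔ (FOLocalConv Gs ∧ ElemConv Gs) := by
  exact ⟨fun h => ⟨fun p _ φ _ => h p φ, Gaif.elem_of_fo h⟩, fun h => Gaif.fo_of_local h.1 h.2⟩
end

section
/- Let d ∈ ℕ and let (G_n) be a sequence of finite graphs with maximum degree at most d such that |G_n| → ∞. Then the following are equivalent: (1) (G_n) is BS-convergent; (2) (G_n) is FO₁^local-convergent; (3) (G_n) is FO^local-convergent. -/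
open FirstOrder Filter

/-- Rooted-graph isomorphism: a graph isomorphism mapping root to root. -/
def RootedIso {A B : Type*} (G : SimpleGraph A) (a : A) (H : SimpleGraph B) (b : B) : Prop :=
  ∃ e : G ≃g H, e a = b

/-- `B_G(x,r)`: the subgraph of `G` induced by the vertices at distance at most `r`
from `x` (rooted at `x`, see `ballRoot`). -/
def ballAt {V : Type} (G : SimpleGraph V) (x : V) (r : ℕ) : SimpleGraph (ballSet G r {x}) :=
  G.induce (ballSet G r {x})

/-- The root of the ball `B_G(x,r)`. -/
def ballRoot {V : Type} (G : SimpleGraph V) (x : V) (r : ℕ) : ballSet G r {x} :=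
  ⟨x, x, rfl, SimpleGraph.Walk.nil, Nat.zero_le r⟩

/-- The graph `G` has maximum degree at most `d`. -/
def DegLE {V : Type} (G : SimpleGraph V) (d : ℕ) : Prop :=
  ∀ x : V, Nat.card (G.neighborSet x) ≤ d

/-- BS-convergence (Benjamini–Schramm, local weak convergence) of a sequence of finite graphs
with maximum degree at most `d`: for every radius `r` and every finite rooted connected graph
`(F,o)` with maximum degree at most `d`, the proportion of vertices whose `r`-ball is
isomorphic to `(F,o)` converges. -/
def BSConv (d : ℕ) (Gs : ℕ → FinGraph) : Prop :=
  ∀ (r : ℕ) (W : Type) [Fintype W] (F : SimpleGraph W) (o : W),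
    F.Connected → DegLE F d →
    ∃ ℓ : ℝ, Tendsto
      (fun n => (Nat.card {x : (Gs n).V //
          RootedIso (ballAt (Gs n).graph x r) (ballRoot (Gs n).graph x r) F o} : ℝ) /
        (Nat.card (Gs n).V : ℝ)) atTop (nhds ℓ)

/-- `FO₁^local`-convergence: densities of local formulas with (at most) one free variable
converge. -/
def FO1LocalConv (Gs : ℕ → FinGraph) : Prop :=
  ∀ (r : ℕ) (φ : Language.graph.Formula (Fin 1)), IsLocalFormula r φ →
    ∃ ℓ : ℝ, Tendsto (fun n => gDens (Gs n).graph φ) atTop (nhds ℓ)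

namespace BSProof

open Language

theorem gRealize_iso {V W : Type} {G : SimpleGraph V} {H : SimpleGraph W} (e : G ≃g H) {p : ℕ}
    (φ : Language.graph.Formula (Fin p)) (v : Fin p → V) :
    gRealize G φ v ↔ gRealize H φ (fun i => e (v i)) := by
  let := G.structure
  let := H.structure
  let E : V ≃[Language.graph] W :=
    { e.toEquiv with
      map_fun' := fun f => isEmptyElim f
      map_rel' := by
        intro n r x
        cases r
        exact e.map_adj_iff }
  exact (StrongHomClass.realize_formula E φ (v := v)).symm

/-- Uniform definability of a property of tuples in graphs. -/
def UDef {α : Type} (P : ∀ (V : Type) (_ : SimpleGraph V), (α → V) → Prop) : Prop :=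
  ∃ φ : Language.graph.Formula α, ∀ (V : Type) (G : SimpleGraph V) (v : α → V),
    (haveI := G.structure; φ.Realize v) ↔ P V G v

theorem UDef.eq {α : Type} (a b : α) : UDef (fun _ _ v => v a = v b) :=
  ⟨(Term.var a).equal (Term.var b), fun V G v => by simp [Formula.realize_equal]⟩

theorem UDef.adj {α : Type} (a b : α) : UDef (fun _ G v => G.Adj (v a) (v b)) :=
  ⟨Relations.formula₂ (L := Language.graph) Language.adj (Term.var a) (Term.var b), fun V G v => by
    let := G.structure
    rw [Formula.realize_rel₂]; rfl⟩

theorem UDef.not {α : Type} {P : ∀ (V : Type) (_ : SimpleGraph V), (α → V) → Prop}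
    (h : UDef P) : UDef (fun V G v => ¬ P V G v) := by
  obtain ⟨φ, h⟩ := h
  exact ⟨φ.not, fun V G v => by
    let := G.structure
    rw [Formula.realize_not, h]⟩

theorem UDef.and {α : Type} {P Q : ∀ (V : Type) (_ : SimpleGraph V), (α → V) → Prop}
    (h : UDef P) (h' : UDef Q) : UDef (fun V G v => P V G v ∧ Q V G v) := by
  obtain ⟨φ, h⟩ := h
  obtain ⟨ψ, h'⟩ := h'
  exact ⟨φ ⊓ ψ, fun V G v => by
    let := G.structure
    rw [Formula.realize_inf, h, h']⟩

theorem UDef.congr {α : Type} {P Q : ∀ (V : Type) (_ : SimpleGraph V), (α → V) → Prop}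
    (h : UDef P) (h' : ∀ V G v, P V G v ↔ Q V G v) : UDef Q := by
  obtain ⟨φ, h⟩ := h
  exact ⟨φ, fun V G v => by rw [h, h']⟩

theorem UDef.or {α : Type} {P Q : ∀ (V : Type) (_ : SimpleGraph V), (α → V) → Prop}
    (h : UDef P) (h' : UDef Q) : UDef (fun V G v => P V G v ∨ Q V G v) :=
  (h.not.and h'.not).not.congr fun V G v => by tauto

theorem UDef.iff {α : Type} {P Q : ∀ (V : Type) (_ : SimpleGraph V), (α → V) → Prop}
    (h : UDef P) (h' : UDef Q) : UDef (fun V G v => P V G v ↔ Q V G v) :=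
  ((h.and h').or (h.not.and h'.not)).congr fun V G v => by tauto

theorem UDef.iAll {α β : Type} [Finite β]
    {P : β → ∀ (V : Type) (_ : SimpleGraph V), (α → V) → Prop}
    (h : ∀ b, UDef (P b)) : UDef (fun V G v => ∀ b, P b V G v) := by
  choose φ h using h
  exact ⟨Formula.iInf φ, fun V G v => by simp [h]⟩

theorem UDef.iEx {α β : Type} [Finite β]
    {P : β → ∀ (V : Type) (_ : SimpleGraph V), (α → V) → Prop}
    (h : ∀ b, UDef (P b)) : UDef (fun V G v => ∃ b, P b V G v) := by
  choose φ h using h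
  exact ⟨Formula.iSup φ, fun V G v => by simp [h]⟩

theorem UDef.relabel {α β : Type} {P : ∀ (V : Type) (_ : SimpleGraph V), (α → V) → Prop}
    (h : UDef P) (g : α → β) : UDef (fun V G v => P V G (v ∘ g)) := by
  obtain ⟨φ, h⟩ := h
  exact ⟨φ.relabel g, fun V G v => by
    let := G.structure
    rw [Formula.realize_relabel, h]⟩

theorem UDef.exs {α β : Type} [Finite β]
    {P : ∀ (V : Type) (_ : SimpleGraph V), (α ⊕ β → V) → Prop}
    (h : UDef P) : UDef (fun V G v => ∃ w : β → V, P V G (Sum.elim v w)) := by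
  obtain ⟨φ, h⟩ := h
  exact ⟨φ.iExs β, fun V G v => by
    let := G.structure
    rw [Formula.realize_iExs]
    exact exists_congr fun w => h V G _⟩

theorem UDef.ex1 {α : Type}
    {P : ∀ (V : Type) (_ : SimpleGraph V), (α ⊕ Unit → V) → Prop}
    (h : UDef P) : UDef (fun V G v => ∃ w : V, P V G (Sum.elim v (fun _ => w))) :=
  h.exs.congr fun _ _ _ =>
    ⟨fun ⟨w, hw⟩ => ⟨w (), hw⟩, fun ⟨w, hw⟩ => ⟨fun _ => w, hw⟩⟩

theorem UDef.all1 {α : Type}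
    {P : ∀ (V : Type) (_ : SimpleGraph V), (α ⊕ Unit → V) → Prop}
    (h : UDef P) : UDef (fun V G v => ∀ w : V, P V G (Sum.elim v (fun _ => w))) :=
  h.not.ex1.not.congr fun V G v => by simp

/-- Being joined by a walk of length at most `n`. -/
def Near {V : Type} (G : SimpleGraph V) : ℕ → V → V → Prop
  | 0, x, y => x = y
  | n + 1, x, y => Near G n x y ∨ ∃ z, Near G n x z ∧ G.Adj z y

theorem near_iff {V : Type} (G : SimpleGraph V) (n : ℕ) (x y : V) :
    Near G n x y ↔ ∃ w : G.Walk x y, w.length ≤ n := by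
  induction n generalizing y with
  | zero =>
    simp only [Near]
    constructor
    · rintro rfl; exact ⟨.nil, le_rfl⟩
    · rintro ⟨w, hw⟩; exact SimpleGraph.Walk.eq_of_length_eq_zero (Nat.le_zero.1 hw)
  | succ n ih =>
    simp only [Near, ih]
    constructor
    · rintro (⟨w, hw⟩ | ⟨z, ⟨w, hw⟩, h⟩)
      · exact ⟨w, by omega⟩
      · exact ⟨w.concat h, by rw [SimpleGraph.Walk.length_concat]; omega⟩
    · rintro ⟨w, hw⟩
      induction w using SimpleGraph.Walk.concatRec with
      | Hnil => exact Or.inl ⟨.nil, Nat.zero_le _⟩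
      | Hconcat w h _ =>
        rw [SimpleGraph.Walk.length_concat] at hw
        exact Or.inr ⟨_, ⟨w, by omega⟩, h⟩

theorem mem_ballSet_singleton {V : Type} (G : SimpleGraph V) (r : ℕ) (x y : V) :
    y ∈ ballSet G r {x} ↔ Near G r x y := by
  rw [near_iff]; simp [ballSet]

theorem mem_ballSet {V : Type} (G : SimpleGraph V) (r : ℕ) (S : Set V) (y : V) :
    y ∈ ballSet G r S ↔ ∃ s ∈ S, Near G r s y := by
  simp [ballSet, near_iff]

theorem Near.refl {V : Type} (G : SimpleGraph V) (n : ℕ) (x : V) : Near G n x x :=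
  (near_iff ..).2 ⟨.nil, Nat.zero_le _⟩

theorem Near.symm {V : Type} {G : SimpleGraph V} {n : ℕ} {x y : V} (h : Near G n x y) :
    Near G n y x := by
  obtain ⟨w, hw⟩ := (near_iff ..).1 h
  exact (near_iff ..).2 ⟨w.reverse, by simpa using hw⟩

theorem Near.trans {V : Type} {G : SimpleGraph V} {n m : ℕ} {x y z : V} (h : Near G n x y)
    (h' : Near G m y z) : Near G (n + m) x z := by
  obtain ⟨w, hw⟩ := (near_iff ..).1 h
  obtain ⟨w', hw'⟩ := (near_iff ..).1 h'
  exact (near_iff ..).2 ⟨w.append w', by simp; omega⟩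

theorem Near.mono {V : Type} {G : SimpleGraph V} {n m : ℕ} {x y : V} (h : Near G n x y)
    (hm : n ≤ m) : Near G m x y := by
  obtain ⟨w, hw⟩ := (near_iff ..).1 h
  exact (near_iff ..).2 ⟨w, by omega⟩

theorem Near.of_adj {V : Type} {G : SimpleGraph V} {x y : V} (h : G.Adj x y) :
    Near G 1 x y := Or.inr ⟨x, rfl, h⟩

theorem Near.map {V W : Type} {G : SimpleGraph V} {H : SimpleGraph W} (e : G →g H) {n : ℕ}
    {x y : V} (h : Near G n x y) : Near H n (e x) (e y) := by
  obtain ⟨w, hw⟩ := (near_iff ..).1 h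
  exact (near_iff ..).2 ⟨w.map e, by simpa using hw⟩

theorem Near.induce {V : Type} {G : SimpleGraph V} {S : Set V} {r : ℕ} {x : V} (hx : x ∈ S)
    (hS : ∀ y, Near G r x y → y ∈ S) {n : ℕ} (hn : n ≤ r) {y : V} (hy : y ∈ S)
    (h : Near G n x y) : Near (G.induce S) n ⟨x, hx⟩ ⟨y, hy⟩ := by
  induction n generalizing y with
  | zero => exact Subtype.ext h
  | succ n ih =>
    rcases h with h | ⟨z, hz, h⟩
    · exact Or.inl (ih (by omega) hy h)
    · have hzS := hS z (hz.mono (by omega))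
      exact Or.inr ⟨⟨z, hzS⟩, ih (by omega) hzS hz, h⟩

theorem UDef.near {α : Type} (n : ℕ) (a b : α) : UDef (fun _ G v => Near G n (v a) (v b)) := by
  induction n generalizing α with
  | zero => exact UDef.eq a b
  | succ n ih =>
    exact (ih a b).or (UDef.ex1 ((ih (α := α ⊕ Unit) (.inl a) (.inr ())).and
      (UDef.adj (α := α ⊕ Unit) (.inr ()) (.inl b))))

/-- The property that the ball around the free variable is isomorphic to `(F,o)`. -/
def BallIs (r : ℕ) {W : Type} (F : SimpleGraph W) (o : W) (V : Type) (G : SimpleGraph V)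
    (v : Fin 1 → V) : Prop :=
  ∃ y : W → V, (((∀ a b, y a = y b ↔ a = b) ∧ y o = v 0) ∧ (∀ a b, G.Adj (y a) (y b) ↔ F.Adj a b)) ∧
    ∀ z, Near G r (v 0) z ↔ ∃ a, y a = z

theorem UDef.const {α : Type} [Nonempty α] (p : Prop) : UDef (α := α) (fun _ _ _ => p) := by
  obtain ⟨a⟩ := ‹Nonempty α›
  by_cases hp : p
  · exact (UDef.eq a a).congr fun V G v => by simp [hp]
  · exact (UDef.eq a a).not.congr fun V G v => by simp [hp]

theorem UDef.ballIs (r : ℕ) {W : Type} [Finite W] (F : SimpleGraph W) (o : W) :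
    UDef (BallIs r F o) := by
  refine UDef.exs (P := fun V G (v : Fin 1 ⊕ W → V) =>
    (((∀ a b, v (.inr a) = v (.inr b) ↔ a = b) ∧ v (.inr o) = v (.inl 0)) ∧
      (∀ a b, G.Adj (v (.inr a)) (v (.inr b)) ↔ F.Adj a b)) ∧
    ∀ z, Near G r (v (.inl 0)) z ↔ ∃ a, v (.inr a) = z) ?_
  refine (((UDef.iAll fun a => UDef.iAll fun b => (UDef.eq _ _).iff (UDef.const _)).and
    (UDef.eq _ _)).and (UDef.iAll fun a => UDef.iAll fun b => (UDef.adj _ _).iff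
      (UDef.const _))).and ?_
  exact UDef.all1 ((UDef.near (α := (Fin 1 ⊕ W) ⊕ Unit) r (.inl (.inl 0)) (.inr ())).iff
    (UDef.iEx fun a => UDef.eq (.inl (.inr a)) (.inr ())))

theorem ballIs_iff (r : ℕ) {W : Type} (F : SimpleGraph W) (o : W) {V : Type} (G : SimpleGraph V)
    (v : Fin 1 → V) :
    BallIs r F o V G v ↔ RootedIso (ballAt G (v 0) r) (ballRoot G (v 0) r) F o := by
  constructor
  · rintro ⟨y, ⟨⟨hinj, ho⟩, hadj⟩, hz⟩
    have hmem : ∀ a, y a ∈ ballSet G r {v 0} := fun a =>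
      (mem_ballSet_singleton ..).2 ((hz _).2 ⟨a, rfl⟩)
    let f : W ≃ ballSet G r {v 0} := Equiv.ofBijective (fun a => ⟨y a, hmem a⟩)
      ⟨fun a b h => (hinj a b).1 (congrArg Subtype.val h), fun ⟨z, h⟩ => by
        obtain ⟨a, ha⟩ := (hz z).1 ((mem_ballSet_singleton ..).1 h)
        exact ⟨a, Subtype.ext ha⟩⟩
    let e : F ≃g ballAt G (v 0) r := ⟨f, fun {a b} => hadj a b⟩
    refine ⟨e.symm, ?_⟩
    rw [RelIso.symm_apply_eq]
    exact Subtype.ext ho.symm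
  · rintro ⟨e, he⟩
    refine ⟨fun a => (e.symm a).1, ⟨⟨fun a b => ?_, ?_⟩, fun a b => ?_⟩, fun z => ?_⟩
    · rw [← Subtype.ext_iff, EmbeddingLike.apply_eq_iff_eq]
    · simp only [← he, RelIso.symm_apply_apply]; rfl
    · exact e.symm.map_adj_iff
    · rw [← mem_ballSet_singleton]
      exact ⟨fun h => ⟨e ⟨z, h⟩, by simp⟩, by rintro ⟨a, rfl⟩; exact (e.symm a).2⟩

theorem ballIs_local (r : ℕ) {W : Type} (F : SimpleGraph W) (o : W) {V : Type} (G : SimpleGraph V)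
    (v : Fin 1 → V) :
    BallIs r F o V G v ↔ BallIs r F o _ (G.induce (ballSet G r (Set.range v)))
      (fun i => ⟨v i, v i, Set.mem_range_self i, SimpleGraph.Walk.nil, Nat.zero_le r⟩) := by
  have hS : ∀ z, z ∈ ballSet G r (Set.range v) ↔ Near G r (v 0) z := by
    intro z
    rw [mem_ballSet]
    constructor
    · rintro ⟨_, ⟨i, rfl⟩, h⟩
      rwa [Subsingleton.elim i 0] at h
    · exact fun h => ⟨_, ⟨0, rfl⟩, h⟩
  have hN : ∀ z : ballSet G r (Set.range v), Near (G.induce (ballSet G r (Set.range v))) r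
      ⟨v 0, v 0, Set.mem_range_self 0, SimpleGraph.Walk.nil, Nat.zero_le r⟩ z := fun z =>
    Near.induce _ (fun y hy => (hS y).2 hy) le_rfl z.2 ((hS z.1).1 z.2)
  constructor
  · rintro ⟨y, ⟨⟨hinj, ho⟩, hadj⟩, hz⟩
    refine ⟨fun a => ⟨y a, (hS _).2 ((hz _).2 ⟨a, rfl⟩)⟩, ⟨⟨fun a b => ?_, Subtype.ext ho⟩,
      fun a b => hadj a b⟩, fun z => ?_⟩
    · rw [Subtype.ext_iff]; exact hinj a b
    · refine ⟨fun _ => ?_, fun _ => hN z⟩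
      obtain ⟨a, ha⟩ := (hz z.1).1 ((hS _).1 z.2)
      exact ⟨a, Subtype.ext ha⟩
  · rintro ⟨y, ⟨⟨hinj, ho⟩, hadj⟩, hz⟩
    refine ⟨fun a => (y a).1, ⟨⟨fun a b => ?_, congrArg Subtype.val ho⟩,
      fun a b => hadj a b⟩, fun z => ?_⟩
    · rw [← Subtype.ext_iff]; exact hinj a b
    · constructor
      · intro h
        obtain ⟨a, ha⟩ := (hz ⟨z, (hS _).2 h⟩).1 (hN _)
        exact ⟨a, congrArg Subtype.val ha⟩
      · rintro ⟨a, rfl⟩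
        exact (hS _).1 (y a).2

theorem fo1_to_bs (d : ℕ) (Gs : ℕ → FinGraph) (h : FO1LocalConv Gs) : BSConv d Gs := by
  intro r W _ F o _ _
  obtain ⟨φ, hφ⟩ := UDef.ballIs r F o
  obtain ⟨ℓ, hℓ⟩ := h r φ (fun V G v => by
    unfold gRealize
    rw [hφ, hφ]
    exact ballIs_local r F o G v)
  refine ⟨ℓ, hℓ.congr fun n => ?_⟩
  unfold gDens
  rw [pow_one]
  congr 2
  refine Nat.card_congr (Equiv.subtypeEquiv (Equiv.funUnique (Fin 1) _) fun v => ?_)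
  rw [hφ, ballIs_iff]
  rfl

theorem rootedIso_symm {A B : Type*} {G : SimpleGraph A} {a : A} {H : SimpleGraph B} {b : B}
    (h : RootedIso G a H b) : RootedIso H b G a := by
  obtain ⟨e, rfl⟩ := h
  exact ⟨e.symm, e.symm_apply_apply a⟩

theorem rootedIso_trans {A B C : Type*} {G : SimpleGraph A} {a : A} {H : SimpleGraph B} {b : B}
    {K : SimpleGraph C} {c : C}
    (h : RootedIso G a H b) (h' : RootedIso H b K c) : RootedIso G a K c := by
  obtain ⟨e, rfl⟩ := h
  obtain ⟨f, rfl⟩ := h'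
  exact ⟨e.trans f, rfl⟩

open Classical in
theorem ball_card {V : Type} [Fintype V] (G : SimpleGraph V) (d : ℕ) (hd : DegLE G d) (r : ℕ)
    (x : V) : (Finset.univ.filter (Near G r x)).card ≤ (d + 1) ^ r := by
  induction r with
  | zero =>
    rw [pow_zero, Finset.card_le_one]
    intro a ha b hb
    replace ha : x = a := (Finset.mem_filter.1 ha).2
    replace hb : x = b := (Finset.mem_filter.1 hb).2
    rw [← ha, hb]
  | succ n ih =>
    have hsub : Finset.univ.filter (Near G (n + 1) x) ⊆
        (Finset.univ.filter (Near G n x)).biUnion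
          (fun z => insert z (G.neighborSet z).toFinset) := by
      intro y hy
      replace hy : Near G n x y ∨ ∃ z, Near G n x z ∧ G.Adj z y := (Finset.mem_filter.1 hy).2
      simp only [Finset.mem_biUnion, Finset.mem_filter, Finset.mem_univ, true_and,
        Finset.mem_insert, Set.mem_toFinset, SimpleGraph.mem_neighborSet]
      rcases hy with hy | ⟨z, hz, h⟩
      · exact ⟨y, hy, Or.inl rfl⟩
      · exact ⟨z, hz, Or.inr h⟩
    refine (Finset.card_le_card hsub).trans ((Finset.card_biUnion_le_card_mul _ _ (d + 1) ?_).trans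
      ?_)
    · intro z _
      refine (Finset.card_insert_le _ _).trans ?_
      have := hd z
      rw [Nat.card_eq_fintype_card, ← Set.toFinset_card] at this
      omega
    · rw [pow_succ]
      exact Nat.mul_le_mul_right _ ih

theorem ballSet_card {V : Type} [Fintype V] (G : SimpleGraph V) (d : ℕ) (hd : DegLE G d) (r : ℕ)
    (x : V) : Nat.card (ballSet G r {x}) ≤ (d + 1) ^ r := by
  classical
  refine le_trans (le_of_eq ?_) (ball_card G d hd r x)
  rw [Nat.card_eq_fintype_card, ← Set.toFinset_card]
  congr 1
  ext y
  simp [mem_ballSet_singleton]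

/-- Codes for finite rooted graphs with at most `N` vertices. -/
abbrev Code (N : ℕ) : Type := Σ n : Fin (N + 1), SimpleGraph (Fin n) × Fin n

/-- The type of a vertex: the set of all codes isomorphic to its ball. -/
def tau {V : Type} (G : SimpleGraph V) (r N : ℕ) (x : V) : Set (Code N) :=
  {t | RootedIso (ballAt G x r) (ballRoot G x r) t.2.1 t.2.2}

theorem tau_nonempty {V : Type} [Fintype V] (G : SimpleGraph V) (r N : ℕ) (x : V)
    (h : Nat.card (ballSet G r {x}) ≤ N) : (tau G r N x).Nonempty := by
  let e := Finite.equivFin (ballSet G r {x})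
  exact ⟨⟨⟨Nat.card (ballSet G r {x}), by omega⟩, (ballAt G x r).map e.toEmbedding,
    e (ballRoot G x r)⟩, SimpleGraph.Iso.map e _, rfl⟩

theorem tau_eq_iff {V V' : Type} {G : SimpleGraph V} {G' : SimpleGraph V'} {r N : ℕ} {x : V}
    {x' : V'} {t : Code N} (ht : t ∈ tau G r N x) :
    t ∈ tau G' r N x' ↔ tau G' r N x' = tau G r N x := by
  constructor
  · intro ht'
    have hxx := rootedIso_trans ht (rootedIso_symm ht')
    ext s
    exact ⟨fun hs => rootedIso_trans hxx hs, fun hs => rootedIso_trans (rootedIso_symm hxx) hs⟩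
  · intro h; rw [h]; exact ht

theorem ballAt_connected {V : Type} (G : SimpleGraph V) (r : ℕ) (x : V) :
    (ballAt G x r).Connected := by
  rw [SimpleGraph.connected_iff_exists_forall_reachable]
  refine ⟨ballRoot G x r, fun y => ?_⟩
  have h := Near.induce (G := G) (S := ballSet G r {x}) (ballRoot G x r).2
    (fun y hy => (mem_ballSet_singleton ..).2 hy) le_rfl y.2 ((mem_ballSet_singleton ..).1 y.2)
  obtain ⟨w, _⟩ := (near_iff ..).1 h
  exact ⟨w⟩

theorem ballAt_degLE {V : Type} [Fintype V] (G : SimpleGraph V) (d : ℕ) (hd : DegLE G d) (r : ℕ)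
    (x : V) : DegLE (ballAt G x r) d := by
  intro y
  refine le_trans ?_ (hd y.1)
  refine Nat.card_le_card_of_injective
    (fun z : (ballAt G x r).neighborSet y => (⟨z.1.1, z.2⟩ : G.neighborSet y.1)) ?_
  intro a b h
  exact Subtype.ext (Subtype.ext (congrArg (fun q => q.1) h))

theorem degLE_iso {V W : Type} {G : SimpleGraph V} {H : SimpleGraph W} (e : G ≃g H) {d : ℕ}
    (h : DegLE G d) : DegLE H d := by
  intro y
  rw [Nat.card_congr (e.symm.mapNeighborSet y)]
  exact h _

/-- Tuples whose entries are pairwise far apart. -/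
def Far {V : Type} (G : SimpleGraph V) (r : ℕ) {p : ℕ} (v : Fin p → V) : Prop :=
  ∀ i j, i ≠ j → ¬ Near G (2 * r + 1) (v i) (v j)

theorem Far.eq_of_near {V : Type} {G : SimpleGraph V} {r p : ℕ} {v : Fin p → V} (h : Far G r v)
    {i j : Fin p} {a b : V} (ha : Near G r (v i) a) (hb : Near G r (v j) b)
    (hab : Near G 1 a b) : i = j := by
  by_contra hij
  exact h i j hij (((ha.trans hab).trans hb.symm).mono (by omega))

/-- Gluing the balls around the entries of a tuple. -/
noncomputable def glue {V : Type} {G : SimpleGraph V} {r p : ℕ} {v : Fin p → V} (h : Far G r v) :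
    (Σ i, ballSet G r {v i}) ≃ ballSet G r (Set.range v) :=
  Equiv.ofBijective (fun a => ⟨a.2.1, (mem_ballSet ..).2
      ⟨v a.1, ⟨a.1, rfl⟩, (mem_ballSet_singleton ..).1 a.2.2⟩⟩) <| by
    constructor
    · rintro ⟨i, a, ha⟩ ⟨j, b, hb⟩ hab
      obtain rfl : a = b := congrArg Subtype.val hab
      obtain rfl : i = j := h.eq_of_near ((mem_ballSet_singleton ..).1 ha)
        ((mem_ballSet_singleton ..).1 hb) (Near.refl ..)
      rfl
    · rintro ⟨a, ha⟩
      obtain ⟨_, ⟨i, rfl⟩, hi⟩ := (mem_ballSet ..).1 ha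
      exact ⟨⟨i, a, (mem_ballSet_singleton ..).2 hi⟩, rfl⟩

theorem same_types {V V' : Type} {G : SimpleGraph V} {G' : SimpleGraph V'} {r p : ℕ}
    {φ : Language.graph.Formula (Fin p)} (hφ : IsLocalFormula r φ)
    {v : Fin p → V} {v' : Fin p → V'} (h : Far G r v) (h' : Far G' r v')
    (hiso : ∀ i, RootedIso (ballAt G (v i) r) (ballRoot G (v i) r)
      (ballAt G' (v' i) r) (ballRoot G' (v' i) r)) :
    gRealize G φ v ↔ gRealize G' φ v' := by
  choose e he using hiso
  let E : ballSet G r (Set.range v) ≃ ballSet G' r (Set.range v') :=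
    (glue h).symm.trans ((Equiv.sigmaCongrRight fun i => (e i).toEquiv).trans (glue h'))
  have hE : ∀ i a, E (glue h ⟨i, a⟩) = glue h' ⟨i, e i a⟩ := by
    intro i a
    simp [E]
  have hadj : ∀ x y, (G'.induce (ballSet G' r (Set.range v'))).Adj (E x) (E y) ↔
      (G.induce (ballSet G r (Set.range v))).Adj x y := by
    intro x y
    obtain ⟨⟨i, a⟩, rfl⟩ := (glue h).surjective x
    obtain ⟨⟨j, b⟩, rfl⟩ := (glue h).surjective y
    rw [hE, hE]
    change G'.Adj (e i a).1 (e j b).1 ↔ G.Adj a.1 b.1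
    by_cases hij : i = j
    · subst hij
      exact (e i).map_adj_iff (v := a) (w := b)
    · refine iff_of_false (fun hc => hij ?_) (fun hc => hij ?_)
      · exact h'.eq_of_near ((mem_ballSet_singleton ..).1 (e i a).2)
          ((mem_ballSet_singleton ..).1 (e j b).2) (Near.of_adj hc)
      · exact h.eq_of_near ((mem_ballSet_singleton ..).1 a.2)
          ((mem_ballSet_singleton ..).1 b.2) (Near.of_adj hc)
  let EI : G.induce (ballSet G r (Set.range v)) ≃g G'.induce (ballSet G' r (Set.range v')) :=
    ⟨E, fun {a b} => hadj a b⟩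
  rw [hφ V G v, hφ V' G' v', gRealize_iso EI]
  have : ∀ i, EI ⟨v i, v i, Set.mem_range_self i, SimpleGraph.Walk.nil, Nat.zero_le r⟩ =
      ⟨v' i, v' i, Set.mem_range_self i, SimpleGraph.Walk.nil, Nat.zero_le r⟩ := by
    intro i
    have := hE i (ballRoot G (v i) r)
    rw [he i] at this
    exact this
  simp only [this]

open Classical in
theorem card_types {V Q : Type} [Fintype V] [Fintype Q] {p : ℕ} (τ : V → Q)
    (S : Finset (Fin p → Q)) :
    (Finset.univ.filter fun v : Fin p → V => (fun i => τ (v i)) ∈ S).card =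
      ∑ s ∈ S, ∏ i, (Finset.univ.filter fun x => τ x = s i).card := by
  rw [Finset.card_eq_sum_card_fiberwise (f := fun v i => τ (v i)) (t := S)]
  · refine Finset.sum_congr rfl fun s hs => ?_
    rw [← Fintype.card_piFinset]
    congr 1
    ext v
    simp only [Finset.mem_filter, Finset.mem_univ, true_and, Fintype.mem_piFinset, funext_iff]
    refine ⟨fun h => h.2, fun h => ⟨?_, h⟩⟩
    rwa [funext h]
  · intro v hv
    simpa using hv

open Classical in
theorem card_bad_pair {V : Type} [Fintype V] (G : SimpleGraph V) (C k : ℕ)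
    (hC : ∀ x, (Finset.univ.filter (Near G k x)).card ≤ C) {p : ℕ} (i j : Fin p) (hij : i ≠ j) :
    (Finset.univ.filter fun v : Fin p → V => Near G k (v i) (v j)).card ≤
      C * Fintype.card V ^ (p - 1) := by
  have := Finset.card_le_mul_card_image_of_maps_to
    (s := Finset.univ.filter fun v : Fin p → V => Near G k (v i) (v j))
    (f := fun v (l : {l : Fin p // l ≠ j}) => v l.1) (t := Finset.univ)
    (fun _ _ => Finset.mem_univ _) C ?_
  · simpa using this
  · intro w _
    refine le_trans (Finset.card_le_card_of_injOn (fun v => v j) ?_ ?_) (hC (w ⟨i, hij⟩))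
    · intro v hv
      simp only [Finset.coe_filter, Finset.mem_filter, Finset.mem_univ, true_and,
        Set.mem_ofPred_eq] at hv ⊢
      rw [← hv.2]
      exact hv.1
    · intro v hv v' hv' hvv
      simp only [Finset.coe_filter, Finset.mem_filter, Finset.mem_univ, true_and,
        Set.mem_ofPred_eq] at hv hv' hvv
      funext l
      by_cases hl : l = j
      · rw [hl]; exact hvv
      · have := congrFun (hv.2.trans hv'.2.symm) ⟨l, hl⟩
        exact this

open Classical in
theorem card_bad {V : Type} [Fintype V] (G : SimpleGraph V) (C r : ℕ)
    (hC : ∀ x, (Finset.univ.filter (Near G (2 * r + 1) x)).card ≤ C) (p : ℕ) :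
    (Finset.univ.filter fun v : Fin p → V => ¬ Far G r v).card ≤
      (p * p) * (C * Fintype.card V ^ (p - 1)) := by
  have hsub : (Finset.univ.filter fun v : Fin p → V => ¬ Far G r v) ⊆
      (Finset.univ.filter fun q : Fin p × Fin p => q.1 ≠ q.2).biUnion fun q =>
        Finset.univ.filter fun v : Fin p → V => Near G (2 * r + 1) (v q.1) (v q.2) := by
    intro v hv
    replace hv := (Finset.mem_filter.1 hv).2
    unfold Far at hv
    push Not at hv
    obtain ⟨i, j, hij, h⟩ := hv
    simp only [Finset.mem_biUnion, Finset.mem_filter, Finset.mem_univ, true_and]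
    exact ⟨(i, j), hij, h⟩
  refine (Finset.card_le_card hsub).trans ((Finset.card_biUnion_le_card_mul _ _
    (C * Fintype.card V ^ (p - 1)) ?_).trans ?_)
  · intro q hq
    exact card_bad_pair G C _ hC q.1 q.2 (by simpa using hq)
  · refine Nat.mul_le_mul_right _ ((Finset.card_filter_le _ _).trans ?_)
    simp

open Classical in
theorem dens_approx {V Q : Type} [Fintype V] [Nonempty V] [Fintype Q] (G : SimpleGraph V)
    (C r p : ℕ) (hC : ∀ x, (Finset.univ.filter (Near G (2 * r + 1) x)).card ≤ C)
    (τ : V → Q) (S : Finset (Fin p → Q)) (φ : Language.graph.Formula (Fin p))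
    (h : ∀ v, Far G r v → (gRealize G φ v ↔ (fun i => τ (v i)) ∈ S)) :
    |gDens G φ - ∑ s ∈ S, ∏ i, ((Nat.card {x // τ x = s i} : ℝ) / (Nat.card V : ℝ))| ≤
      (p * p * C : ℝ) / (Nat.card V : ℝ) := by
  set A := Finset.univ.filter fun v : Fin p → V => gRealize G φ v with hA
  set B := Finset.univ.filter fun v : Fin p → V => (fun i => τ (v i)) ∈ S with hB
  set D := Finset.univ.filter fun v : Fin p → V => ¬ Far G r v with hD
  have hV : (0 : ℝ) < Fintype.card V := by exact_mod_cast Fintype.card_pos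
  have h1 : A.card ≤ B.card + D.card := by
    refine (Finset.card_le_card ?_).trans (Finset.card_union_le _ _)
    intro v hv
    simp only [hA, hB, hD, Finset.mem_union, Finset.mem_filter, Finset.mem_univ, true_and] at hv ⊢
    by_cases hf : Far G r v
    · exact Or.inl ((h v hf).1 hv)
    · exact Or.inr hf
  have h2 : B.card ≤ A.card + D.card := by
    refine (Finset.card_le_card ?_).trans (Finset.card_union_le _ _)
    intro v hv
    simp only [hA, hB, hD, Finset.mem_union, Finset.mem_filter, Finset.mem_univ, true_and] at hv ⊢
    by_cases hf : Far G r v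
    · exact Or.inl ((h v hf).2 hv)
    · exact Or.inr hf
  have h3 : gDens G φ = (A.card : ℝ) / (Fintype.card V : ℝ) ^ p := by
    have : Nat.card {v : Fin p → V // gRealize G φ v} = A.card := by
      rw [Nat.card_eq_fintype_card, Fintype.card_subtype]
    rw [← this, ← Nat.card_eq_fintype_card]
    rfl
  have h4 : ∑ s ∈ S, ∏ i, ((Nat.card {x // τ x = s i} : ℝ) / (Nat.card V : ℝ)) =
      (B.card : ℝ) / (Fintype.card V : ℝ) ^ p := by
    rw [hB, card_types τ S]
    push_cast
    rw [Finset.sum_div]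
    refine Finset.sum_congr rfl fun s _ => ?_
    rw [Finset.prod_div_distrib]
    simp [Fintype.card_subtype]
  have h5 : (D.card : ℝ) ≤ (p * p) * (C * (Fintype.card V : ℝ) ^ (p - 1)) := by
    exact_mod_cast card_bad G C r hC p
  have h6 : |(A.card : ℝ) - B.card| ≤ D.card := by
    rw [abs_le]
    have h1' : (A.card : ℝ) ≤ B.card + D.card := by exact_mod_cast h1
    have h2' : (B.card : ℝ) ≤ A.card + D.card := by exact_mod_cast h2
    constructor <;> linarith
  rw [h3, h4, ← sub_div, abs_div, abs_of_pos (pow_pos hV p), Nat.card_eq_fintype_card,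
    div_le_div_iff₀ (pow_pos hV p) hV]
  refine (mul_le_mul_of_nonneg_right (h6.trans h5) hV.le).trans (le_of_eq ?_)
  rcases p with _ | p
  · simp
  · simp only [Nat.add_sub_cancel]
    ring

theorem types_conv (d r N : ℕ) (hN : (d + 1) ^ r ≤ N) (Gs : ℕ → FinGraph)
    (hdeg : ∀ n, DegLE (Gs n).graph d) (h : BSConv d Gs) (q : Set (Code N)) :
    ∃ ℓ : ℝ, Tendsto (fun n => (Nat.card {x : (Gs n).V // tau (Gs n).graph r N x = q} : ℝ) /
      (Nat.card (Gs n).V : ℝ)) atTop (nhds ℓ) := by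
  by_cases hq : ∃ n, ∃ x : (Gs n).V, tau (Gs n).graph r N x = q
  · obtain ⟨m, x, rfl⟩ := hq
    obtain ⟨t, ht⟩ := tau_nonempty (Gs m).graph r N x
      ((ballSet_card _ d (hdeg m) r x).trans hN)
    have ht' := ht
    obtain ⟨e, he⟩ := ht'
    obtain ⟨ℓ, hℓ⟩ := h r _ t.2.1 t.2.2 (e.connected_iff.1 (ballAt_connected ..))
      (degLE_iso e (ballAt_degLE _ d (hdeg m) r x))
    refine ⟨ℓ, hℓ.congr fun n => ?_⟩
    congr 2
    exact Nat.card_congr (Equiv.subtypeEquivRight fun y => tau_eq_iff ht)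
  · push Not at hq
    refine ⟨0, tendsto_const_nhds.congr fun n => ?_⟩
    have : IsEmpty {x : (Gs n).V // tau (Gs n).graph r N x = q} := ⟨fun x => hq n x.1 x.2⟩
    simp

theorem bs_to_fo (d : ℕ) (Gs : ℕ → FinGraph) (hdeg : ∀ n, DegLE (Gs n).graph d)
    (hcard : Tendsto (fun n => Nat.card (Gs n).V) atTop atTop) (h : BSConv d Gs) :
    FOLocalConv Gs := by
  classical
  intro p r φ hφ
  let N := (d + 1) ^ r
  choose ℓ hℓ using types_conv d r N le_rfl Gs hdeg h
  have : Fintype (Set (Code N)) := Fintype.ofFinite _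
  let S : Finset (Fin p → Set (Code N)) := Finset.univ.filter fun s =>
    ∃ n, ∃ v : Fin p → (Gs n).V, Far (Gs n).graph r v ∧ gRealize (Gs n).graph φ v ∧
      (fun i => tau (Gs n).graph r N (v i)) = s
  have key : ∀ n (v : Fin p → (Gs n).V), Far (Gs n).graph r v →
      (gRealize (Gs n).graph φ v ↔ (fun i => tau (Gs n).graph r N (v i)) ∈ S) := by
    intro n v hv
    simp only [S, Finset.mem_filter, Finset.mem_univ, true_and]
    constructor
    · exact fun hr => ⟨n, v, hv, hr, rfl⟩
    · rintro ⟨m, v', hv', hr, heq⟩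
      refine (same_types hφ hv' hv fun i => ?_).1 hr
      obtain ⟨t, ht⟩ := tau_nonempty (Gs n).graph r N (v i) (ballSet_card _ d (hdeg n) r _)
      have ht' : t ∈ tau (Gs m).graph r N (v' i) := by
        have := congrFun heq i
        change tau (Gs m).graph r N (v' i) = tau (Gs n).graph r N (v i) at this
        rw [this]; exact ht
      exact rootedIso_trans ht' (rootedIso_symm ht)
  let C := (d + 1) ^ (2 * r + 1)
  have happ := fun n => dens_approx (Gs n).graph C r p
    (fun x => ball_card _ d (hdeg n) _ x) (tau (Gs n).graph r N) S φ (key n)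
  have hlim : Tendsto (fun n => ∑ s ∈ S, ∏ i, ((Nat.card {x // tau (Gs n).graph r N x = s i} : ℝ) /
      (Nat.card (Gs n).V : ℝ))) atTop (nhds (∑ s ∈ S, ∏ i, ℓ (s i))) :=
    tendsto_finsetSum _ fun s _ => tendsto_finsetProd _ fun i _ => hℓ (s i)
  have herr := squeeze_zero_norm (f := fun n => gDens (Gs n).graph φ - ∑ s ∈ S, ∏ i,
    ((Nat.card {x // tau (Gs n).graph r N x = s i} : ℝ) / (Nat.card (Gs n).V : ℝ))) happ
    ((tendsto_const_nhds (x := (p * p * C : ℝ))).div_atTop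
      (tendsto_natCast_atTop_atTop.comp hcard))
  refine ⟨0 + ∑ s ∈ S, ∏ i, ℓ (s i), (herr.add hlim).congr fun n => ?_⟩
  simp

end BSProof

/-- For a sequence `(G_n)` of finite graphs with maximum degree at most `d`
and `|G_n| → ∞`, the following are equivalent: (1) `(G_n)` is BS-convergent;
(2) `(G_n)` is `FO₁^local`-convergent; (3) `(G_n)` is `FO^local`-convergent. -/
theorem bsConv_iff_fo1LocalConv_iff_foLocalConv (d : ℕ) (Gs : ℕ → FinGraph)
    (hdeg : ∀ n, DegLE (Gs n).graph d)
    (hcard : Tendsto (fun n => Nat.card (Gs n).V) atTop atTop) :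
    (BSConv d Gs ↔ FO1LocalConv Gs) ∧ (FO1LocalConv Gs ↔ FOLocalConv Gs) := by
  have h1 := BSProof.fo1_to_bs d Gs
  have h2 := BSProof.bs_to_fo d Gs hdeg hcard
  have h3 : FOLocalConv Gs → FO1LocalConv Gs := fun h r φ hφ => h 1 r φ hφ
  exact ⟨⟨fun h => h3 (h2 h), h1⟩, ⟨fun h => h2 (h1 h), h3⟩⟩
end
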